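/- arXiv:0905.1082 — 3 statements merged into one kernel-verified Lean document; each statement's English description precedes it below -/
import Mathlib

section
/- Let k be an infinite field of characteristic p ≠ 2 and let m ≥ 1 be an integer. Set b_m = ⌊m/2⌋ + 1. Then T(G(m)), the set of identities of G(m), equals the T-ideal of k⟨X⟩ generated by the two elements [[x_1,x_2],x_3] and h_{b_m} = ∏_{r=1}^{b_m} [x_{2r−1}, x_{2r}]. That is, f ∈ k⟨X⟩ satisfies φ(f) = 0 for every k-algebra homomorphism φ : k⟨X⟩ → G(m) if and only if f lies in the two-sided ideal of k⟨X⟩ generated by all images of these two elements under k-algebra endomorphisms of k⟨X⟩. -/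
noncomputable section

/-- The `i`-th variable `x_i` of the free unital associative algebra `k⟨X⟩`. -/
def xx (k : Type*) [Field k] (i : ℕ) : FreeAlgebra k ℕ := FreeAlgebra.ι k i

/-- Commutator `[a,b] = ab - ba`. -/
def brk {A : Type*} [Ring A] (a b : A) : A := a * b - b * a

/-- `h_j = ∏_{r=1}^{j} [x_{2r-1}, x_{2r}]`. -/
def hh (k : Type*) [Field k] (j : ℕ) : FreeAlgebra k ℕ :=
  ((List.range j).map (fun r => brk (xx k (2 * r + 1)) (xx k (2 * r + 2)))).prod

/-- The product `[x_{i₁}, x_{i₂}] [x_{i₃}, x_{i₄}] ⋯` along a list of indices; it is `0` for a list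
of odd length. -/
def brkProd {A : Type*} [Ring A] (x : ℕ → A) : List ℕ → A
  | [] => 1
  | [_] => 0
  | a :: b :: l => brk (x a) (x b) * brkProd x l

section Brk

variable {A : Type*} [Ring A]

lemma brk_self (a : A) : brk a a = 0 := sub_self _

lemma brk_swap (a b : A) : brk b a = -brk a b := (neg_sub _ _).symm

lemma map_brk {B F : Type*} [Ring B] [FunLike F A B] [RingHomClass F A B] (f : F) (a b : A) :
    f (brk a b) = brk (f a) (f b) := by
  simp [brk]

lemma map_brkProd {B F : Type*} [Ring B] [FunLike F A B] [RingHomClass F A B] (f : F) (x : ℕ → A) :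
    ∀ l : List ℕ, f (brkProd x l) = brkProd (fun i => f (x i)) l
  | [] => map_one f
  | [_] => map_zero f
  | a :: b :: l => by
    rw [brkProd, brkProd, map_mul, map_brk, map_brkProd f x l]

lemma brkProd_eq_zero_of_odd (x : ℕ → A) : ∀ l : List ℕ, Odd l.length → brkProd x l = 0
  | [], h => by simp at h
  | [_], _ => rfl
  | a :: b :: l, h => by
    rw [brkProd, brkProd_eq_zero_of_odd x l (by simpa [parity_simps] using h), mul_zero]

lemma exists_brkProd_eq_mul (x : ℕ → A) (b : ℕ) : ∀ l : List ℕ, 2 * b ≤ l.length →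
    ∃ (y : ℕ → A) (t : A), brkProd x l =
      ((List.range b).map (fun r => brk (y (2 * r + 1)) (y (2 * r + 2)))).prod * t := by
  induction b with
  | zero => exact fun l _ => ⟨x, brkProd x l, by simp⟩
  | succ b ih =>
    intro l hl
    match l, hl with
    | [], hl => simp at hl
    | [_], hl => simp at hl; omega
    | i :: j :: l, hl =>
      obtain ⟨y, t, h⟩ := ih l (by simp at hl; omega)
      refine ⟨fun n => match n with
        | 0 => 0
        | 1 => x i
        | 2 => x j
        | n + 3 => y (n + 1), t, ?_⟩
      rw [List.range_succ_eq_map, List.map_cons, List.prod_cons, brkProd, h, List.map_map,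
        mul_assoc]
      rfl

variable (hA : ∀ a b c : A, brk (brk a b) c = 0)
include hA

lemma brk_mul_comm (a b c : A) : brk a b * c = c * brk a b := sub_eq_zero.1 (hA a b c)

lemma brk_mul_brk_swap (a b c d : A) : brk a b * brk c d = -(brk a c * brk b d) := by
  have h := hA (a * c) b d
  have e : brk (a * c) b = a * brk c b + brk a b * c := by
    simp only [brk]; noncomm_ring
  have e' : brk (a * brk c b + brk a b * c) d
      = a * brk (brk c b) d + brk a d * brk c b + brk a b * brk c d + brk (brk a b) d * c := by
    simp only [brk]; noncomm_ring
  have h1 := hA (a * b) c d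
  have e1 : brk (a * b) c = a * brk b c + brk a c * b := by
    simp only [brk]; noncomm_ring
  have e1' : brk (a * brk b c + brk a c * b) d
      = a * brk (brk b c) d + brk a d * brk b c + brk a c * brk b d + brk (brk a c) d * b := by
    simp only [brk]; noncomm_ring
  rw [e, e', hA, hA, mul_zero, zero_mul, add_zero, zero_add] at h
  rw [e1, e1', hA, hA, mul_zero, zero_mul, add_zero, zero_add] at h1
  rw [brk_swap b c, mul_neg] at h
  rw [eq_neg_iff_add_eq_zero]
  calc _ = (-(brk a d * brk b c) + brk a b * brk c d) + (brk a d * brk b c + brk a c * brk b d) := by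
        abel
    _ = 0 := by rw [h, h1, add_zero]

lemma brkProd_mul_comm (x : ℕ → A) (c : A) : ∀ l : List ℕ, brkProd x l * c = c * brkProd x l
  | [] => by simp [brkProd]
  | [_] => by simp [brkProd]
  | a :: b :: l => by
    rw [brkProd, mul_assoc, brkProd_mul_comm x c l, ← mul_assoc, brk_mul_comm hA, mul_assoc]

lemma brkProd_swap (x : ℕ → A) (i j : ℕ) (v : List ℕ) : ∀ u : List ℕ,
    brkProd x (u ++ i :: j :: v) = -brkProd x (u ++ j :: i :: v)
  | [] => by
    simp only [List.nil_append, brkProd]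
    rw [brk_swap (x j) (x i), neg_mul]
  | [a] => by
    match v with
    | [] => simp [brkProd]
    | d :: t =>
      simp only [List.cons_append, List.nil_append, brkProd]
      rw [← mul_assoc, ← mul_assoc, brk_mul_brk_swap hA, neg_mul]
  | a :: b :: u => by
    simp only [List.cons_append, brkProd]
    rw [brkProd_swap x i j v u, mul_neg]

lemma brkProd_perm (x : ℕ → A) {l l' : List ℕ} (h : l.Perm l') : ∀ u : List ℕ,
    brkProd x (u ++ l) = brkProd x (u ++ l') ∨ brkProd x (u ++ l) = -brkProd x (u ++ l') := by
  induction h with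
  | nil => exact fun u => Or.inl rfl
  | cons a _ ih => intro u; simpa using ih (u ++ [a])
  | swap i j l => exact fun u => Or.inr (brkProd_swap hA x _ _ _ u)
  | trans _ _ ih ih' =>
    intro u
    rcases ih u with h | h <;> rcases ih' u with h' | h' <;> simp [h, h']

lemma brkProd_eq_zero_of_not_nodup (x : ℕ → A) {l : List ℕ} (h : ¬l.Nodup) : brkProd x l = 0 := by
  obtain ⟨i, hi⟩ := List.exists_duplicate_iff_not_nodup.2 h
  obtain ⟨v, hv⟩ := (List.duplicate_iff_sublist.1 hi).exists_perm_append
  have := brkProd_perm hA x hv []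
  simpa [brkProd, brk_self] using this

section Span

variable (k : Type*) [Field k] [Algebra k A] (x : ℕ → A)

/-- The span of the products of a sorted monomial with commutators of generators. -/
def monoBrkSpan : Submodule k A :=
  Submodule.span k (Set.range fun p : Multiset ℕ × List ℕ =>
    (p.1.toList.map x).prod * brkProd x p.2)

omit hA in
lemma mul_brk_mem (hA : ∀ a b c : A, brk (brk a b) c = 0) (i j : ℕ) {a : A}
    (ha : a ∈ monoBrkSpan k x) : a * brk (x i) (x j) ∈ monoBrkSpan k x := by
  refine Submodule.span_induction (p := fun a _ => a * brk (x i) (x j) ∈ monoBrkSpan k x)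
    ?_ ?_ ?_ ?_ ha
  · rintro _ ⟨⟨s, l⟩, rfl⟩
    refine Submodule.subset_span ⟨(s, i :: j :: l), ?_⟩
    simp only [brkProd]
    rw [mul_assoc, brkProd_mul_comm hA]
  · simp
  · intro a b _ _ h h'
    rw [add_mul]; exact add_mem h h'
  · intro c a _ h
    rw [smul_mul_assoc]; exact Submodule.smul_mem _ _ h

lemma word_sub_mem {n : ℕ} (hn : ∀ l : List ℕ, l.length < n → (l.map x).prod ∈ monoBrkSpan k x)
    {l l' : List ℕ} (h : l.Perm l') : ∀ u : List ℕ, (u ++ l).length = n →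
      ((u ++ l).map x).prod - ((u ++ l').map x).prod ∈ monoBrkSpan k x := by
  induction h with
  | nil => intro u _; simp
  | cons a _ ih => intro u hu; simpa using ih (u ++ [a]) (by simpa using hu)
  | swap i j l =>
    intro u hu
    have := mul_brk_mem k x hA j i (hn (u ++ l) (by simp at hu ⊢; omega))
    convert this using 1
    simp only [List.map_append, List.map_cons, List.prod_append, List.prod_cons]
    rw [mul_assoc, ← brk_mul_comm hA]
    simp only [brk]; noncomm_ring
  | trans h _ ih ih' =>
    intro u hu
    have := add_mem (ih u hu) (ih' u (by simpa [h.length_eq] using hu))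
    rwa [sub_add_sub_cancel] at this

lemma word_mem (l : List ℕ) : (l.map x).prod ∈ monoBrkSpan k x := by
  induction hn : l.length using Nat.strong_induction_on generalizing l with
  | _ n ih =>
    have h1 := word_sub_mem hA k x (n := n) (fun l hl => ih _ hl l rfl)
      (l := l) (l' := (l : Multiset ℕ).toList)
      (Multiset.coe_eq_coe.1 (Multiset.coe_toList _).symm) [] hn
    have h2 : (((l : Multiset ℕ).toList).map x).prod ∈ monoBrkSpan k x :=
      Submodule.subset_span ⟨((l : Multiset ℕ), []), by simp [brkProd]⟩
    simpa using add_mem h1 h2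

omit hA in
lemma lift_mem_span_words (f : FreeAlgebra k ℕ) : FreeAlgebra.lift k x f ∈
    Submodule.span k (Set.range fun l : List ℕ => (l.map x).prod) := by
  induction f using FreeAlgebra.induction with
  | grade0 r =>
    rw [AlgHom.commutes, Algebra.algebraMap_eq_smul_one]
    exact Submodule.smul_mem _ _ (Submodule.subset_span ⟨[], by simp⟩)
  | grade1 i => exact Submodule.subset_span ⟨[i], by simp⟩
  | mul a b ha hb =>
    rw [map_mul]
    have := Submodule.mul_mem_mul ha hb
    rw [Submodule.span_mul_span] at this
    refine Submodule.span_mono ?_ this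
    rintro _ ⟨_, ⟨l, rfl⟩, _, ⟨l', rfl⟩, rfl⟩
    exact ⟨l ++ l', by simp⟩
  | add a b ha hb => rw [map_add]; exact add_mem ha hb

/-- Normal form: every element of the algebra generated by the `x i` is a combination of products of
a sorted monomial with commutators along a finite set of even size less than `2 * b`. -/
lemma lift_mem_span_normal {b : ℕ}
    (hb : ∀ y : ℕ → A, ((List.range b).map (fun r => brk (y (2 * r + 1)) (y (2 * r + 2)))).prod = 0)
    (f : FreeAlgebra k ℕ) : FreeAlgebra.lift k x f ∈
    Submodule.span k ((fun p : Finset ℕ × Multiset ℕ =>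
      (p.2.toList.map x).prod * brkProd x p.1.toList) '' {p | Even p.1.card ∧ p.1.card < 2 * b}) := by
  have h1 : FreeAlgebra.lift k x f ∈ monoBrkSpan k x := by
    refine Submodule.span_le.2 ?_ (lift_mem_span_words k x f)
    rintro _ ⟨l, rfl⟩
    exact word_mem hA k x l
  refine Submodule.span_le.2 ?_ h1
  rintro _ ⟨⟨s, l⟩, rfl⟩
  by_cases hl : l.Nodup
  swap
  · simp [brkProd_eq_zero_of_not_nodup hA x hl]
  rcases Nat.even_or_odd l.length with he | ho
  swap
  · simp [brkProd_eq_zero_of_odd x l ho]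
  by_cases hlen : l.length < 2 * b
  swap
  · obtain ⟨y, t, h⟩ := exists_brkProd_eq_mul x b l (not_lt.1 hlen)
    simp [h, hb]
  have hc : l.toFinset.card = l.length := List.toFinset_card_of_nodup hl
  have hmem : (s.toList.map x).prod * brkProd x l.toFinset.toList ∈
      Submodule.span k ((fun p : Finset ℕ × Multiset ℕ =>
        (p.2.toList.map x).prod * brkProd x p.1.toList) ''
          {p | Even p.1.card ∧ p.1.card < 2 * b}) :=
    Submodule.subset_span ⟨(l.toFinset, s), ⟨by rwa [hc], by rwa [hc]⟩, rfl⟩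
  rcases brkProd_perm hA x (List.toFinset_toList hl).symm [] with h | h <;>
    simp only [List.nil_append] at h
  · simpa [h] using hmem
  · simpa [h] using hmem

end Span

end Brk

section Exterior

variable {k M : Type*} [Field k] [AddCommGroup M] [Module k M]

local notation "Λ" => ExteriorAlgebra k M

lemma ι_mul_ι_comm (u v : M) : ExteriorAlgebra.ι k v * ExteriorAlgebra.ι k u =
    -(ExteriorAlgebra.ι k u * ExteriorAlgebra.ι k v) :=
  eq_neg_of_add_eq_zero_left (ExteriorAlgebra.ι_add_mul_swap v u)

lemma ι_mul_ι_mem_center (u v : M) :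
    ExteriorAlgebra.ι k u * ExteriorAlgebra.ι k v ∈ Subalgebra.center k Λ := by
  rw [Subalgebra.mem_center_iff]
  intro c
  induction c using ExteriorAlgebra.induction with
  | algebraMap r => exact Algebra.commutes _ _
  | ι w =>
    rw [← mul_assoc, ι_mul_ι_comm u w, neg_mul, mul_assoc, ι_mul_ι_comm v w, mul_neg, neg_neg,
      mul_assoc]
  | mul a b ha hb => rw [mul_assoc, hb, ← mul_assoc, ha, mul_assoc]
  | add a b ha hb => rw [add_mul, mul_add, ha, hb]

variable (k M) in
/-- The span of the products of a vector with a central element. -/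
def vecCenter : Submodule k Λ :=
  LinearMap.range (ExteriorAlgebra.ι k (M := M)) * (Subalgebra.center k Λ).toSubmodule

variable (k M) in
/-- The span of the products of two vectors with a central element. -/
def vecVecCenter : Submodule k Λ :=
  LinearMap.range (ExteriorAlgebra.ι k (M := M)) ^ 2 * (Subalgebra.center k Λ).toSubmodule

lemma center_sup_vecCenter :
    (Subalgebra.center k Λ).toSubmodule ⊔ vecCenter k M = ⊤ := by
  rw [eq_top_iff]
  rintro c -
  have key : ∀ c : Λ, ∀ d ∈ (Subalgebra.center k Λ).toSubmodule ⊔ vecCenter k M,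
      c * d ∈ (Subalgebra.center k Λ).toSubmodule ⊔ vecCenter k M := by
    intro c
    induction c using ExteriorAlgebra.induction with
    | algebraMap r =>
      intro d hd
      rw [← Algebra.smul_def]
      exact Submodule.smul_mem _ _ hd
    | ι w =>
      intro d hd
      obtain ⟨z, hz, o, ho, rfl⟩ := Submodule.mem_sup.1 hd
      rw [mul_add]
      refine add_mem (Submodule.mem_sup_right (Submodule.mul_mem_mul ⟨w, rfl⟩ hz))
        (Submodule.mem_sup_left ?_)
      refine Submodule.mul_induction_on ho ?_ ?_
      · rintro _ ⟨v, rfl⟩ z' hz'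
        rw [← mul_assoc]
        exact Subalgebra.mul_mem (Subalgebra.center k Λ) (ι_mul_ι_mem_center w v) hz'
      · intro a b ha hb
        rw [mul_add]
        exact add_mem ha hb
    | mul a b ha hb => intro d hd; rw [mul_assoc]; exact ha _ (hb _ hd)
    | add a b ha hb => intro d hd; rw [add_mul]; exact add_mem (ha _ hd) (hb _ hd)
  simpa using key c 1 (Submodule.mem_sup_left (one_mem (Subalgebra.center k Λ)))

lemma brk_mem_of_mem_vecCenter {a b : Λ} (ha : a ∈ vecCenter k M) (hb : b ∈ vecCenter k M) :
    brk a b ∈ vecVecCenter k M := by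
  refine Submodule.mul_induction_on ha ?_ ?_
  · rintro _ ⟨u, rfl⟩ z hz
    refine Submodule.mul_induction_on hb ?_ ?_
    · rintro _ ⟨v, rfl⟩ w hw
      have hz' := (Subalgebra.mem_center_iff (R := k)).1 hz
      have hw' := (Subalgebra.mem_center_iff (R := k)).1 hw
      have h : brk (ExteriorAlgebra.ι k u * z) (ExteriorAlgebra.ι k v * w) =
          (2 : k) • ((ExteriorAlgebra.ι k u * ExteriorAlgebra.ι k v) * (z * w)) := by
        rw [brk, mul_assoc _ z, ← mul_assoc z, ← hz', mul_assoc _ w, ← mul_assoc w, ← hw',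
          mul_assoc _ w z, mul_assoc _ z w, ← hw' z, ← mul_assoc,
          ← mul_assoc (ExteriorAlgebra.ι k v), ι_mul_ι_comm u v, two_smul, neg_mul, sub_neg_eq_add]
      rw [h]
      refine Submodule.smul_mem _ _ (Submodule.mul_mem_mul ?_ (Subalgebra.mul_mem (Subalgebra.center k Λ) hz hw))
      rw [pow_two]
      exact Submodule.mul_mem_mul ⟨u, rfl⟩ ⟨v, rfl⟩
    · intro b b' h h'
      have := add_mem h h'
      convert this using 1
      simp only [brk]; noncomm_ring
  · intro b b' h h'
    have := add_mem h h'
    convert this using 1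
    simp only [brk]; noncomm_ring

lemma brk_mem_vecVecCenter (a b : Λ) : brk a b ∈ vecVecCenter k M := by
  have h := center_sup_vecCenter (k := k) (M := M)
  obtain ⟨z, hz, o, ho, rfl⟩ := Submodule.mem_sup.1 (h ▸ Submodule.mem_top : a ∈ _)
  obtain ⟨w, hw, q, hq, rfl⟩ := Submodule.mem_sup.1 (h ▸ Submodule.mem_top : b ∈ _)
  have hz' := (Subalgebra.mem_center_iff (R := k)).1 hz
  have hw' := (Subalgebra.mem_center_iff (R := k)).1 hw
  have : brk (z + o) (w + q) = brk o q := by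
    simp only [brk, add_mul, mul_add, hz' w, hz' q, hw' o]
    abel
  rw [this]
  exact brk_mem_of_mem_vecCenter ho hq

lemma vecVecCenter_le_center : vecVecCenter k M ≤ (Subalgebra.center k Λ).toSubmodule := by
  refine Submodule.mul_le.2 fun a ha z hz => Subalgebra.mul_mem (Subalgebra.center k Λ) ?_ hz
  rw [pow_two] at ha
  refine Submodule.mul_induction_on ha ?_ fun _ _ => add_mem
  rintro _ ⟨u, rfl⟩ _ ⟨v, rfl⟩
  exact ι_mul_ι_mem_center u v

lemma exterior_brk_brk (a b c : Λ) : brk (brk a b) c = 0 :=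
  sub_eq_zero.2 ((Subalgebra.mem_center_iff (R := k)).1
    (vecVecCenter_le_center (brk_mem_vecVecCenter a b)) c).symm

lemma prod_mem_pow_mul_center : ∀ l : List Λ, (∀ a ∈ l, a ∈ vecVecCenter k M) →
    l.prod ∈ LinearMap.range (ExteriorAlgebra.ι k (M := M)) ^ (2 * l.length) *
      (Subalgebra.center k Λ).toSubmodule
  | [], _ => by
    simp
  | a :: l, h => by
    rw [List.prod_cons, List.length_cons, mul_add, mul_one, add_comm, pow_add]
    have ih := prod_mem_pow_mul_center l fun b hb => h b (List.mem_cons_of_mem _ hb)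
    refine Submodule.mul_induction_on (h a List.mem_cons_self) ?_ ?_
    · intro p hp z hz
      refine Submodule.mul_induction_on ih ?_ ?_
      · intro q hq w hw
        have hz' := (Subalgebra.mem_center_iff (R := k)).1 hz
        rw [mul_assoc p, ← mul_assoc z, ← hz', mul_assoc q, ← mul_assoc]
        exact Submodule.mul_mem_mul (Submodule.mul_mem_mul hp hq) (Subalgebra.mul_mem (Subalgebra.center k Λ) hz hw)
      · intro b b' hb hb'
        rw [mul_add]; exact add_mem hb hb'
    · intro b b' hb hb'
      rw [add_mul]; exact add_mem hb hb'

lemma range_ι_pow_eq_bot [FiniteDimensional k M] {n : ℕ} (hn : Module.finrank k M < n) :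
    LinearMap.range (ExteriorAlgebra.ι k (M := M)) ^ n = ⊥ := by
  rw [eq_bot_iff, ← ExteriorAlgebra.exteriorPower, ← ExteriorAlgebra.ιMulti_span_fixedDegree,
    Submodule.span_le]
  rintro _ ⟨v, rfl⟩
  refine (AlternatingMap.map_linearDependent _ v fun hv => ?_)
  have := hv.fintype_card_le_finrank
  simp at this
  omega

lemma exterior_prod_brk [FiniteDimensional k M] {b : ℕ} (hb : Module.finrank k M < 2 * b)
    (y : ℕ → Λ) :
    ((List.range b).map (fun r => brk (y (2 * r + 1)) (y (2 * r + 2)))).prod = 0 := by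
  have h := prod_mem_pow_mul_center (k := k) (M := M)
    ((List.range b).map (fun r => brk (y (2 * r + 1)) (y (2 * r + 2)))) (by
      intro a ha
      obtain ⟨r, -, rfl⟩ := List.mem_map.1 ha
      exact brk_mem_vecVecCenter _ _)
  rw [List.length_map, List.length_range, range_ι_pow_eq_bot hb, Submodule.bot_mul] at h
  simpa using h

lemma ιMulti_single_ne_zero {m n : ℕ} (h : n ≤ m) :
    ExteriorAlgebra.ιMulti k n
      (fun i : Fin n => (Pi.single (Fin.castLE h i) 1 : Fin m → k)) ≠ 0 := by
  intro h0
  let F : (Fin m → k) [⋀^Fin n]→ₗ[k] k :=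
    (Matrix.detRowAlternating (R := k) (n := Fin n)).compLinearMap
      (LinearMap.funLeft k k (Fin.castLE h))
  have h1 := exteriorPower.alternatingMapLinearEquiv_apply_ιMulti F
    (fun i : Fin n => (Pi.single (Fin.castLE h i) 1 : Fin m → k))
  have h2 : exteriorPower.ιMulti k n
      (fun i : Fin n => (Pi.single (Fin.castLE h i) 1 : Fin m → k)) = 0 :=
    Subtype.ext h0
  rw [h2, map_zero] at h1
  have h3 : F (fun i : Fin n => (Pi.single (Fin.castLE h i) 1 : Fin m → k)) = 1 := by
    have : (fun i : Fin n => LinearMap.funLeft k k (Fin.castLE h)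
        (Pi.single (Fin.castLE h i) 1 : Fin m → k)) = (1 : Matrix (Fin n) (Fin n) k) := by
      ext i j
      simp [LinearMap.funLeft_apply, Pi.single_apply, Matrix.one_apply, Fin.ext_iff, eq_comm]
    change Matrix.det (fun i : Fin n => LinearMap.funLeft k k (Fin.castLE h)
        (Pi.single (Fin.castLE h i) 1 : Fin m → k)) = 1
    rw [this, Matrix.det_one]
  rw [h3] at h1
  exact zero_ne_one h1

lemma ι_mul_prod_map_eq_zero (v : ℕ → M) (i : ℕ) : ∀ l : List ℕ, i ∈ l →
    ExteriorAlgebra.ι k (v i) * (l.map fun j => ExteriorAlgebra.ι k (v j)).prod = 0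
  | j :: l, h => by
    rw [List.map_cons, List.prod_cons, ← mul_assoc]
    by_cases hij : i = j
    · rw [hij, ExteriorAlgebra.ι_sq_zero, zero_mul]
    · rw [ι_mul_ι_comm (v j), neg_mul, mul_assoc,
        ι_mul_prod_map_eq_zero v i l ((List.mem_cons.1 h).resolve_left hij), mul_zero, neg_zero]

lemma brk_algebraMap_add_ι (s t : k) (u v : M) :
    brk (algebraMap k Λ s + ExteriorAlgebra.ι k u) (algebraMap k Λ t + ExteriorAlgebra.ι k v) =
      (2 : k) • (ExteriorAlgebra.ι k u * ExteriorAlgebra.ι k v) := by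
  simp only [brk, mul_add, add_mul, ι_mul_ι_comm u v, two_smul,
    Algebra.commutes s (ExteriorAlgebra.ι k v), ← Algebra.commutes t (ExteriorAlgebra.ι k u),
    Algebra.commutes s (algebraMap k Λ t)]
  abel

lemma brkProd_algebraMap_add_ι (τ : ℕ → k) (v : ℕ → M) : ∀ l : List ℕ, Even l.length →
    brkProd (fun i => algebraMap k Λ (τ i) + ExteriorAlgebra.ι k (v i)) l =
      (2 : k) ^ (l.length / 2) • (l.map fun j => ExteriorAlgebra.ι k (v j)).prod
  | [], _ => by simp [brkProd]
  | [_], h => by simp at h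
  | a :: b :: l, h => by
    have hl : Even l.length := by simpa [parity_simps] using h
    rw [brkProd, brkProd_algebraMap_add_ι τ v l hl, brk_algebraMap_add_ι]
    have : (a :: b :: l).length / 2 = l.length / 2 + 1 := by simp; omega
    rw [this, smul_mul_smul_comm, pow_succ']
    simp [mul_assoc]

lemma word_mul_eq_smul (τ : ℕ → k) (v : ℕ → M) (P : Λ)
    (hP : ∀ i, ExteriorAlgebra.ι k (v i) * P = 0) : ∀ l : List ℕ,
    (l.map fun i => algebraMap k Λ (τ i) + ExteriorAlgebra.ι k (v i)).prod * P =
      (l.map τ).prod • P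
  | [] => by simp
  | i :: l => by
    rw [List.map_cons, List.prod_cons, mul_assoc, word_mul_eq_smul τ v P hP l, mul_smul_comm,
      add_mul, hP, add_zero, ← Algebra.smul_def, smul_smul, List.map_cons, List.prod_cons, mul_comm]

lemma exists_vec {m : ℕ} (S : Finset ℕ) (hS : S.card ≤ m) : ∃ v : ℕ → (Fin m → k),
    (∀ i ∉ S, v i = 0) ∧ (S.toList.map fun i => ExteriorAlgebra.ι k (v i)).prod ≠ 0 := by
  have hlen : S.toList.length = S.card := Finset.length_toList S
  have hlt : ∀ i, i ∈ S → S.toList.idxOf i < m := fun i hi =>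
    (List.idxOf_lt_length_iff.2 (Finset.mem_toList.2 hi)).trans_le (hlen.trans_le hS)
  refine ⟨fun i => if h : i ∈ S then Pi.single ⟨S.toList.idxOf i, hlt i h⟩ 1 else 0,
    fun i hi => dif_neg hi, ?_⟩
  convert ιMulti_single_ne_zero (k := k) hS using 1
  rw [ExteriorAlgebra.ιMulti_apply]
  congr 1
  refine List.ext_getElem (by simp) fun n h1 h2 => ?_
  have hn : n < S.toList.length := by simpa using h1
  have hmem : S.toList[n] ∈ S := Finset.mem_toList.1 (List.getElem_mem hn)
  simp only [List.getElem_map, List.getElem_ofFn]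
  rw [dif_pos hmem]
  congr 2
  exact Fin.ext (S.nodup_toList.idxOf_getElem n hn)

end Exterior

section Normal

variable {k : Type*} [Field k]

/-- The normal form element of the free algebra attached to a set of indices and a monomial. -/
def normalElem (k : Type*) [Field k] (p : Finset ℕ × Multiset ℕ) : FreeAlgebra k ℕ :=
  (p.2.toList.map (FreeAlgebra.ι k)).prod * brkProd (FreeAlgebra.ι k) p.1.toList

lemma lift_normalElem {A : Type*} [Ring A] [Algebra k A] (x : ℕ → A) (p : Finset ℕ × Multiset ℕ) :
    FreeAlgebra.lift k x (normalElem k p) =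
      (p.2.toList.map x).prod * brkProd x p.1.toList := by
  rw [normalElem, map_mul, map_brkProd, map_list_prod, List.map_map]
  simp [Function.comp_def]

lemma eq_zero_of_forall_sum_prod_eq_zero [Infinite k] {σ : Type*} (T : Finset (Multiset σ))
    (c : Multiset σ → k) (h : ∀ τ : σ → k, ∑ s ∈ T, c s * (s.map τ).prod = 0) :
    ∀ s ∈ T, c s = 0 := by
  classical
  have h0 : ∑ s ∈ T, MvPolynomial.monomial (Multiset.toFinsupp s) (c s) = 0 := by
    refine MvPolynomial.funext fun τ => ?_
    rw [map_sum, map_zero, ← h τ]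
    refine Finset.sum_congr rfl fun s _ => ?_
    rw [MvPolynomial.eval_monomial, Finsupp.prod, Multiset.toFinsupp_support,
      Finset.prod_multiset_map_count]
    simp
  intro s hs
  have h1 := congrArg (MvPolynomial.coeff (Multiset.toFinsupp s)) h0
  rw [MvPolynomial.coeff_sum, MvPolynomial.coeff_zero, Finset.sum_eq_single s] at h1
  · simpa using h1
  · intro t _ hts
    rw [MvPolynomial.coeff_monomial, if_neg]
    simpa using hts
  · exact fun h => absurd hs h

/-- Normal form elements are linearly independent modulo the identities of the exterior algebra. -/
lemma coeff_eq_zero_of_identity [Infinite k] (h2 : (2 : k) ≠ 0) {m : ℕ}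
    (c : Finset ℕ × Multiset ℕ →₀ k) (hc : ∀ p ∈ c.support, Even p.1.card ∧ p.1.card ≤ m)
    (h : ∀ φ : FreeAlgebra k ℕ →ₐ[k] ExteriorAlgebra k (Fin m → k),
      φ (c.sum fun p a => a • normalElem k p) = 0) : c = 0 := by
  classical
  by_contra hne
  obtain ⟨⟨S, s₀⟩, hp, hmin⟩ := Finset.exists_min_image c.support (fun p => p.1.card)
    (Finsupp.support_nonempty_iff.2 hne)
  obtain ⟨hev, hle⟩ := hc _ hp
  obtain ⟨v, hv, hP⟩ := exists_vec (k := k) S hle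
  set P := (S.toList.map fun i => ExteriorAlgebra.ι k (v i)).prod with hPdef
  have hιP : ∀ i, ExteriorAlgebra.ι k (v i) * P = 0 := by
    intro i
    by_cases hi : i ∈ S
    · exact ι_mul_prod_map_eq_zero v i _ (Finset.mem_toList.2 hi)
    · rw [hv i hi, map_zero, zero_mul]
  have hother : ∀ S' : Finset ℕ, S.card ≤ S'.card → S' ≠ S →
      (S'.toList.map fun i => ExteriorAlgebra.ι k (v i)).prod = 0 := by
    intro S' hcard hS'
    obtain ⟨i, hi, hiS⟩ := Finset.not_subset.1 fun hsub =>
      hS' (Finset.eq_of_subset_of_card_le hsub hcard)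
    refine List.prod_eq_zero (List.mem_map.2 ⟨i, Finset.mem_toList.2 hi, ?_⟩)
    rw [hv i hiS, map_zero]
  let T : Finset (Multiset ℕ) := (c.support.filter fun p => p.1 = S).image Prod.snd
  have hinj : Set.InjOn Prod.snd (↑(c.support.filter fun p => p.1 = S) : Set (Finset ℕ × Multiset ℕ)) := by
    rintro ⟨a, b⟩ ha ⟨a', b'⟩ ha' hbb
    exact Prod.ext ((Finset.mem_filter.1 ha).2.trans (Finset.mem_filter.1 ha').2.symm) hbb
  have key : ∀ τ : ℕ → k, ∑ s ∈ T, c (S, s) * (s.map τ).prod = 0 := by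
    intro τ
    have h1 := h (FreeAlgebra.lift k fun i => algebraMap k _ (τ i) + ExteriorAlgebra.ι k (v i))
    rw [Finsupp.sum, map_sum] at h1
    have h3 : ∀ p ∈ c.support,
        (FreeAlgebra.lift k fun i => algebraMap k _ (τ i) + ExteriorAlgebra.ι k (v i))
          (c p • normalElem k p) =
        if p.1 = S then (c (S, p.2) * (p.2.map τ).prod) • (2 : k) ^ (S.toList.length / 2) • P
        else 0 := by
      rintro ⟨S', s⟩ hp'
      rw [map_smul, lift_normalElem, brkProd_algebraMap_add_ι _ _ _
        (by simpa using (hc _ hp').1), mul_smul_comm]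
      split_ifs with hS
      · simp only at hS
        subst hS
        rw [word_mul_eq_smul τ v _ hιP, mul_smul, smul_comm (2 ^ _ : k)]
        congr 2
        rw [← Multiset.prod_coe, ← Multiset.map_coe, Multiset.coe_toList]
      · rw [hother S' (hmin _ hp') hS, mul_zero, smul_zero, smul_zero]
    rw [Finset.sum_congr rfl h3, ← Finset.sum_filter, ← Finset.sum_smul] at h1
    rw [Finset.sum_image hinj]
    exact (smul_eq_zero.1 h1).resolve_right (smul_ne_zero (pow_ne_zero _ h2) hP)
  refine Finsupp.mem_support_iff.1 hp (eq_zero_of_forall_sum_prod_eq_zero T (fun s => c (S, s)) key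
    s₀ ?_)
  exact Finset.mem_image.2 ⟨(S, s₀), Finset.mem_filter.2 ⟨hp, rfl⟩, rfl⟩

end Normal

/-- For an infinite field `k` of characteristic `p ≠ 2` and `m ≥ 1`,
the ideal of identities `T(G(m))` equals the T-ideal of `k⟨X⟩` generated by
`[[x_1,x_2],x_3]` and `h_{b_m}`, where `b_m = ⌊m/2⌋ + 1`. -/
theorem stmt1 (k : Type*) [Field k] [Infinite k] (p : ℕ) [CharP k p] (hp : p ≠ 2)
    (m : ℕ) (hm : 1 ≤ m) :
    {f : FreeAlgebra k ℕ |
        ∀ φ : FreeAlgebra k ℕ →ₐ[k] ExteriorAlgebra k (Fin m → k), φ f = 0} =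
    ↑(Submodule.span k {y : FreeAlgebra k ℕ | ∃ a w b : FreeAlgebra k ℕ,
        (∃ ψ : FreeAlgebra k ℕ →ₐ[k] FreeAlgebra k ℕ,
          w = ψ (brk (brk (xx k 1) (xx k 2)) (xx k 3)) ∨ w = ψ (hh k (m / 2 + 1))) ∧
        y = a * w * b}) := by
  set J := Submodule.span k {y : FreeAlgebra k ℕ | ∃ a w b : FreeAlgebra k ℕ,
        (∃ ψ : FreeAlgebra k ℕ →ₐ[k] FreeAlgebra k ℕ,
          w = ψ (brk (brk (xx k 1) (xx k 2)) (xx k 3)) ∨ w = ψ (hh k (m / 2 + 1))) ∧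
        y = a * w * b} with hJ
  have map_hh : ∀ {B : Type _} [Ring B] [Algebra k B] (ψ : FreeAlgebra k ℕ →ₐ[k] B),
      ψ (hh k (m / 2 + 1)) = ((List.range (m / 2 + 1)).map
        (fun r => brk (ψ (xx k (2 * r + 1))) (ψ (xx k (2 * r + 2))))).prod := by
    intro B _ _ ψ
    rw [hh, map_list_prod, List.map_map]
    simp only [Function.comp_def, map_brk]
  have hsub : ∀ f ∈ J, ∀ φ : FreeAlgebra k ℕ →ₐ[k] ExteriorAlgebra k (Fin m → k), φ f = 0 := by
    intro f hf φ
    refine (Submodule.span_le (p := LinearMap.ker φ.toLinearMap)).2 ?_ hf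
    rintro _ ⟨a, w, b, ⟨ψ, hw⟩, rfl⟩
    have : φ w = 0 := by
      rcases hw with rfl | rfl
      · rw [map_brk, map_brk, map_brk, map_brk, exterior_brk_brk]
      · change (φ.comp ψ) _ = 0
        rw [map_hh]
        refine exterior_prod_brk ?_ fun i => (φ.comp ψ) (xx k i)
        rw [Module.finrank_fin_fun]
        omega
    simp [this]
  have hmul_left : ∀ c f, f ∈ J → c * f ∈ J := by
    intro c f hf
    refine (Submodule.span_le (p := J.comap (LinearMap.mulLeft k c))).2 ?_ hf
    rintro _ ⟨a, w, b, hw, rfl⟩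
    exact Submodule.subset_span ⟨c * a, w, b, hw, by simp [mul_assoc]⟩
  have hmul_right : ∀ c f, f ∈ J → f * c ∈ J := by
    intro c f hf
    refine (Submodule.span_le (p := J.comap (LinearMap.mulRight k c))).2 ?_ hf
    rintro _ ⟨a, w, b, hw, rfl⟩
    exact Submodule.subset_span ⟨a, w, b * c, hw, by simp [mul_assoc]⟩
  let I : Ideal (FreeAlgebra k ℕ) :=
    { J.toAddSubmonoid with smul_mem' := fun c f hf => hmul_left c f hf }
  have : I.IsTwoSided := ⟨fun {f} c hf => hmul_right c f hf⟩
  let q : FreeAlgebra k ℕ →ₐ[k] FreeAlgebra k ℕ ⧸ I := Ideal.Quotient.mkₐ k I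
  have hq : ∀ f, q f = 0 ↔ f ∈ J := fun f => Ideal.Quotient.eq_zero_iff_mem
  have hqs : Function.Surjective q := Ideal.Quotient.mkₐ_surjective k I
  have hgen : ∀ w, (∃ ψ : FreeAlgebra k ℕ →ₐ[k] FreeAlgebra k ℕ,
      w = ψ (brk (brk (xx k 1) (xx k 2)) (xx k 3)) ∨ w = ψ (hh k (m / 2 + 1))) → q w = 0 :=
    fun w hw => (hq w).2 (Submodule.subset_span ⟨1, w, 1, hw, by simp⟩)
  have hA : ∀ a b c : FreeAlgebra k ℕ ⧸ I, brk (brk a b) c = 0 := by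
    intro a b c
    obtain ⟨a, rfl⟩ := hqs a
    obtain ⟨b, rfl⟩ := hqs b
    obtain ⟨c, rfl⟩ := hqs c
    have := hgen _ ⟨FreeAlgebra.lift k fun i => if i = 1 then a else if i = 2 then b else c,
      Or.inl rfl⟩
    simpa [map_brk, xx] using this
  have hB : ∀ y : ℕ → FreeAlgebra k ℕ ⧸ I, ((List.range (m / 2 + 1)).map
      (fun r => brk (y (2 * r + 1)) (y (2 * r + 2)))).prod = 0 := by
    intro y
    choose z hz using fun i => hqs (y i)
    have := hgen _ ⟨FreeAlgebra.lift k z, Or.inr rfl⟩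
    change (q.comp (FreeAlgebra.lift k z)) _ = 0 at this
    rw [map_hh] at this
    simpa [xx, hz] using this
  have h2 : (2 : k) ≠ 0 := by
    intro h
    have h' : ((2 : ℕ) : k) = 0 := by exact_mod_cast h
    rcases (Nat.dvd_prime Nat.prime_two).1 ((CharP.cast_eq_zero_iff k p 2).1 h') with h1 | h1
    · exact CharP.char_ne_one k p h1
    · exact hp h1
  ext f
  refine ⟨fun hf => ?_, fun hf => hsub f hf⟩
  have hql : FreeAlgebra.lift k (fun i => q (FreeAlgebra.ι k i)) = q := by
    ext i; simp
  have hspan := lift_mem_span_normal hA k (fun i => q (FreeAlgebra.ι k i)) hB f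
  rw [Finsupp.mem_span_image_iff_linearCombination] at hspan
  obtain ⟨c, hc, hcf⟩ := hspan
  set g := c.sum fun p a => a • normalElem k p with hg
  have hqg : q g = q f := by
    rw [hql] at hcf
    rw [← hcf, hg, Finsupp.linearCombination_apply, Finsupp.sum, Finsupp.sum, map_sum]
    refine Finset.sum_congr rfl fun p _ => ?_
    rw [map_smul, ← lift_normalElem (k := k), hql]
  have hfg : f - g ∈ J := by rw [← hq, map_sub, hqg, sub_self]
  have hc0 : c = 0 := by
    refine coeff_eq_zero_of_identity (m := m) h2 c (fun p hp => ?_) fun φ => ?_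
    · have := (Finsupp.mem_supported k c).1 hc hp
      obtain ⟨r, hr⟩ := this.1
      have hlt : p.1.card < 2 * (m / 2 + 1) := this.2
      exact ⟨this.1, by omega⟩
    · have := hsub _ hfg φ
      rw [map_sub, hf φ, zero_sub, neg_eq_zero] at this
      exact this
  have hg0 : g = 0 := by rw [hg, hc0, Finsupp.sum_zero_index]
  simpa [hg0] using hfg

end
end

section
/- Let k be a field of characteristic different from 2, let m ≥ 1 be an integer, and set b_m = ⌊m/2⌋ + 1. Then for any elements g_1, g_2, …, g_{2b_m} of G(m), the product of commutators ∏_{r=1}^{b_m} [g_{2r−1}, g_{2r}] equals 0 in G(m). -/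
noncomputable section

namespace ExteriorAlgebra

variable {R M : Type*} [CommRing R] [AddCommGroup M] [Module R M]

/-- Left multiplication preserves the right ideal generated by the vectors. -/
theorem mul_mem_range_ι_mul_top (a : ExteriorAlgebra R M) :
    ∀ z ∈ LinearMap.range (ι R : M →ₗ[R] ExteriorAlgebra R M) * ⊤,
      a * z ∈ LinearMap.range (ι R : M →ₗ[R] ExteriorAlgebra R M) * ⊤ := by
  induction a using ExteriorAlgebra.induction with
  | algebraMap r =>
    intro z hz
    rw [← Algebra.smul_def]
    exact Submodule.smul_mem _ r hz
  | ι x => exact fun z _ => Submodule.mul_mem_mul ⟨x, rfl⟩ Submodule.mem_top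
  | mul a b ha hb =>
    intro z hz
    rw [mul_assoc]
    exact ha _ (hb z hz)
  | add a b ha hb =>
    intro z hz
    rw [add_mul]
    exact add_mem (ha z hz) (hb z hz)

theorem top_mul_range_ι_le :
    ⊤ * LinearMap.range (ι R : M →ₗ[R] ExteriorAlgebra R M) ≤
      LinearMap.range (ι R : M →ₗ[R] ExteriorAlgebra R M) * ⊤ := by
  refine Submodule.mul_le.2 fun a _ l hl => mul_mem_range_ι_mul_top a l ?_
  simpa using Submodule.mul_mem_mul hl (Submodule.mem_top (x := (1 : ExteriorAlgebra R M)))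

theorem top_mul_exteriorPower_le (n : ℕ) :
    (⊤ : Submodule R (ExteriorAlgebra R M)) * ⋀[R]^n M ≤ ⋀[R]^n M * ⊤ := by
  induction n with
  | zero => simp
  | succ n ih =>
    calc (⊤ : Submodule R (ExteriorAlgebra R M)) * ⋀[R]^(n + 1) M
        = ⊤ * ⋀[R]^n M * LinearMap.range (ι R) := by rw [exteriorPower, pow_succ, mul_assoc]
      _ ≤ ⋀[R]^n M * ⊤ * LinearMap.range (ι R) := mul_le_mul' ih le_rfl
      _ ≤ ⋀[R]^n M * (LinearMap.range (ι R) * ⊤) := by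
        rw [mul_assoc]
        exact mul_le_mul' le_rfl top_mul_range_ι_le
      _ = ⋀[R]^(n + 1) M * ⊤ := by rw [exteriorPower, exteriorPower, pow_succ, mul_assoc]

theorem exteriorPower_mul_top_mul_le (m n : ℕ) :
    (⋀[R]^m M * ⊤) * (⋀[R]^n M * ⊤) ≤
      ⋀[R]^(m + n) M * (⊤ : Submodule R (ExteriorAlgebra R M)) :=
  calc (⋀[R]^m M * ⊤) * (⋀[R]^n M * ⊤)
      = ⋀[R]^m M * (⊤ * ⋀[R]^n M) * ⊤ := by simp only [mul_assoc]
    _ ≤ ⋀[R]^m M * (⋀[R]^n M * ⊤) * ⊤ :=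
      mul_le_mul' (mul_le_mul' le_rfl (top_mul_exteriorPower_le n)) le_rfl
    _ = ⋀[R]^(m + n) M * (⊤ * ⊤) := by
      simp only [exteriorPower, pow_add, mul_assoc]
    _ ≤ ⋀[R]^(m + n) M * ⊤ := mul_le_mul' le_rfl le_top

theorem mul_mem_exteriorPower_mul_top_left {n : ℕ} (a : ExteriorAlgebra R M)
    {z : ExteriorAlgebra R M} (hz : z ∈ ⋀[R]^n M * (⊤ : Submodule R (ExteriorAlgebra R M))) :
    a * z ∈ ⋀[R]^n M * (⊤ : Submodule R (ExteriorAlgebra R M)) := by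
  have h := exteriorPower_mul_top_mul_le (R := R) (M := M) 0 n
  rw [zero_add] at h
  exact h (Submodule.mul_mem_mul (by simp [exteriorPower]) hz)

theorem mul_mem_exteriorPower_mul_top_right {n : ℕ} (a : ExteriorAlgebra R M)
    {z : ExteriorAlgebra R M} (hz : z ∈ ⋀[R]^n M * (⊤ : Submodule R (ExteriorAlgebra R M))) :
    z * a ∈ ⋀[R]^n M * (⊤ : Submodule R (ExteriorAlgebra R M)) :=
  exteriorPower_mul_top_mul_le n 0 (Submodule.mul_mem_mul hz (by simp [exteriorPower]))

theorem brk_ι_mem (x : M) (b : ExteriorAlgebra R M) :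
    brk (ι R x) b ∈ ⋀[R]^2 M * (⊤ : Submodule R (ExteriorAlgebra R M)) := by
  induction b using ExteriorAlgebra.induction with
  | algebraMap r => simp [brk, Algebra.commutes]
  | ι y =>
    have h : brk (ι R x) (ι R y) = ι R x * ι R y * 2 := by
      rw [brk, eq_neg_of_add_eq_zero_right (ι_add_mul_swap x y), mul_two, sub_neg_eq_add]
    rw [h, exteriorPower, pow_two]
    exact Submodule.mul_mem_mul (Submodule.mul_mem_mul ⟨x, rfl⟩ ⟨y, rfl⟩) Submodule.mem_top
  | mul a b ha hb =>
    have h : brk (ι R x) (a * b) = brk (ι R x) a * b + a * brk (ι R x) b := by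
      unfold brk; noncomm_ring
    rw [h]
    exact add_mem (mul_mem_exteriorPower_mul_top_right b ha)
      (mul_mem_exteriorPower_mul_top_left a hb)
  | add a b ha hb =>
    have h : brk (ι R x) (a + b) = brk (ι R x) a + brk (ι R x) b := by
      unfold brk; noncomm_ring
    exact h ▸ add_mem ha hb

theorem brk_mem (a b : ExteriorAlgebra R M) :
    brk a b ∈ ⋀[R]^2 M * (⊤ : Submodule R (ExteriorAlgebra R M)) := by
  induction a using ExteriorAlgebra.induction with
  | algebraMap r => simp [brk, Algebra.commutes]
  | ι x => exact brk_ι_mem x b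
  | mul a a' ha ha' =>
    have h : brk (a * a') b = a * brk a' b + brk a b * a' := by
      unfold brk; noncomm_ring
    rw [h]
    exact add_mem (mul_mem_exteriorPower_mul_top_left a ha')
      (mul_mem_exteriorPower_mul_top_right a' ha)
  | add a a' ha ha' =>
    have h : brk (a + a') b = brk a b + brk a' b := by
      unfold brk; noncomm_ring
    exact h ▸ add_mem ha ha'

theorem prod_brk_mem (f g : ℕ → ExteriorAlgebra R M) (n : ℕ) :
    ((List.range n).map (fun r => brk (f r) (g r))).prod ∈
      ⋀[R]^(2 * n) M * (⊤ : Submodule R (ExteriorAlgebra R M)) := by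
  induction n with
  | zero => simp [exteriorPower]
  | succ n ih =>
    rw [List.range_succ, List.map_append, List.prod_append, List.map_singleton,
      List.prod_singleton]
    exact exteriorPower_mul_top_mul_le (2 * n) 2 (Submodule.mul_mem_mul ih (brk_mem _ _))

theorem exteriorPower_eq_bot_of_finrank_lt {k V : Type*} [Field k] [AddCommGroup V] [Module k V]
    [FiniteDimensional k V] {n : ℕ} (h : Module.finrank k V < n) : ⋀[k]^n V = ⊥ := by
  rw [← ιMulti_span_fixedDegree, Submodule.span_eq_bot]
  rintro _ ⟨v, rfl⟩
  refine (ιMulti k n).map_linearDependent v fun hv => ?_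
  have := hv.fintype_card_le_finrank
  rw [Fintype.card_fin] at this
  omega

end ExteriorAlgebra

/-- For a field `k` of characteristic `≠ 2`, `m ≥ 1` and
`b_m = ⌊m/2⌋ + 1`, any product of `b_m` commutators `∏_{r=1}^{b_m} [g_{2r-1}, g_{2r}]`
of elements of `G(m)` vanishes. -/
theorem stmt2 (k : Type*) [Field k] (hchar : ringChar k ≠ 2) (m : ℕ) (hm : 1 ≤ m)
    (g : ℕ → ExteriorAlgebra k (Fin m → k)) :
    ((List.range (m / 2 + 1)).map (fun r => brk (g (2 * r + 1)) (g (2 * r + 2)))).prod = 0 := by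
  have h := ExteriorAlgebra.prod_brk_mem (fun r => g (2 * r + 1)) (fun r => g (2 * r + 2))
    (m / 2 + 1)
  rw [ExteriorAlgebra.exteriorPower_eq_bot_of_finrank_lt
    (by rw [Module.finrank_fin_fun]; omega), Submodule.bot_mul] at h
  exact (Submodule.mem_bot k).1 h

end
end

section
/- Let k be an infinite field of characteristic p > 2, let m ≥ 2 be an integer, and set b_m = ⌊m/2⌋ + 1. Then CP(G(m)) = S_1(m) + T(G(m)), where S_1(m) is the T-space of k⟨X⟩ generated by the set {[x_1, x_2], x_1^p, x_{2b_m−1} · h_{b_m−1}} ∪ {x_{2k+1}^p · w_k : k ≥ 1}. -/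
open Pointwise

noncomputable section

/-- `w_n = ∏_{r=1}^{n} [x_{2r-1}, x_{2r}] x_{2r-1}^{p-1} x_{2r}^{p-1}`. -/
def ww (k : Type*) [Field k] (p n : ℕ) : FreeAlgebra k ℕ :=
  ((List.range n).map (fun r =>
    brk (xx k (2 * r + 1)) (xx k (2 * r + 2)) *
      (xx k (2 * r + 1)) ^ (p - 1) * (xx k (2 * r + 2)) ^ (p - 1))).prod

open MvPolynomial in
/-- The polynomial differential forms in countably many variables, as the exterior algebra of the
free module on `dx_0, dx_1, …` over the polynomial ring. -/
abbrev PolyForm (k : Type*) [Field k] :=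
  ExteriorAlgebra (MvPolynomial ℕ k) (ℕ →₀ MvPolynomial ℕ k)

namespace PolyForm

open MvPolynomial

variable {k : Type*} [Field k]

/-- An element of the free module on the `dx_i`, as a differential 1-form. -/
def oneForm : (ℕ →₀ MvPolynomial ℕ k) →ₗ[MvPolynomial ℕ k] PolyForm k :=
  ExteriorAlgebra.ι (MvPolynomial ℕ k)

/-- The universal derivation of the polynomial ring. -/
def grad : Derivation k (MvPolynomial ℕ k) (ℕ →₀ MvPolynomial ℕ k) :=
  mkDerivation k fun i => Finsupp.single i 1

/-- The differential `dx_i`. -/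
def dx (i : ℕ) : PolyForm k := oneForm (Finsupp.single i 1)

/-- The product of the `dx_i` for `i` in a list. -/
def dxs (J : List ℕ) : PolyForm k := (J.map dx).prod

/-- `P ↦ P + dP`. -/
def jet : MvPolynomial ℕ k →ₗ[k] PolyForm k :=
  (Algebra.linearMap (MvPolynomial ℕ k) (PolyForm k)).restrictScalars k +
    (oneForm (k := k)).restrictScalars k ∘ₗ (grad (k := k) : _ →ₗ[k] _)

theorem jet_apply (P : MvPolynomial ℕ k) :
    jet P = algebraMap _ (PolyForm k) P + oneForm (grad P) := rfl

theorem oneForm_single (l : ℕ) (Q : MvPolynomial ℕ k) :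
    oneForm (Finsupp.single l Q) = Q • dx l := by
  rw [dx, ← map_smul, Finsupp.smul_single, smul_eq_mul, mul_one]

theorem oneForm_mul_self (m : ℕ →₀ MvPolynomial ℕ k) : oneForm m * oneForm m = 0 :=
  ExteriorAlgebra.ι_sq_zero m

theorem oneForm_mul_comm (m m' : ℕ →₀ MvPolynomial ℕ k) :
    oneForm m * oneForm m' = -(oneForm m' * oneForm m) :=
  eq_neg_of_add_eq_zero_left (ExteriorAlgebra.ι_add_mul_swap m m')

theorem dx_mul_self (i : ℕ) : (dx i * dx i : PolyForm k) = 0 := oneForm_mul_self _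

theorem dx_mul_comm (i j : ℕ) : (dx i * dx j : PolyForm k) = -(dx j * dx i) :=
  oneForm_mul_comm _ _

theorem commute_coeff (P : MvPolynomial ℕ k) (y : PolyForm k) :
    Commute (algebraMap _ (PolyForm k) P) y := Algebra.commutes P y

@[simp] theorem dxs_nil : (dxs [] : PolyForm k) = 1 := rfl

@[simp] theorem dxs_cons (i : ℕ) (J : List ℕ) : (dxs (i :: J) : PolyForm k) = dx i * dxs J := by
  simp [dxs]

@[simp] theorem dxs_append (J K : List ℕ) :
    (dxs (J ++ K) : PolyForm k) = dxs J * dxs K := by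
  simp [dxs]

theorem oneForm_mul_dxs (m : ℕ →₀ MvPolynomial ℕ k) (J : List ℕ) :
    oneForm m * dxs J = (-1) ^ J.length * (dxs J * oneForm m) := by
  induction J with
  | nil => simp
  | cons i J ih =>
    rw [dxs_cons, ← mul_assoc, dx, oneForm_mul_comm, neg_mul, mul_assoc, ih, List.length_cons,
      pow_succ]
    have : Commute ((-1 : PolyForm k) ^ J.length) (oneForm (Finsupp.single i 1)) :=
      (Commute.neg_one_left _).pow_left _
    rw [← mul_assoc (oneForm (Finsupp.single i 1)), ← this.eq]
    noncomm_ring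

theorem commute_oneForm_dxs (m : ℕ →₀ MvPolynomial ℕ k) {J : List ℕ} (hJ : Even J.length) :
    Commute (oneForm m) (dxs J) := by
  rw [Commute, SemiconjBy, oneForm_mul_dxs, hJ.neg_one_pow, one_mul]

theorem dx_mul_dxs_of_mem {i : ℕ} {J : List ℕ} (h : i ∈ J) : (dx i * dxs J : PolyForm k) = 0 := by
  induction J with
  | nil => simp at h
  | cons j J ih =>
    rw [dxs_cons]
    rcases List.mem_cons.1 h with rfl | h
    · rw [← mul_assoc, dx_mul_self, zero_mul]
    · rw [← mul_assoc, dx_mul_comm, neg_mul, mul_assoc, ih h, mul_zero, neg_zero]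

theorem dxs_eq_zero_of_not_nodup {J : List ℕ} (h : ¬ J.Nodup) : (dxs J : PolyForm k) = 0 := by
  induction J with
  | nil => simp at h
  | cons j J ih =>
    rw [dxs_cons]
    by_cases hj : j ∈ J
    · exact dx_mul_dxs_of_mem hj
    · rw [ih (fun h' => h (List.nodup_cons.2 ⟨hj, h'⟩)), mul_zero]

theorem dxs_perm {J K : List ℕ} (h : J.Perm K) :
    (dxs J : PolyForm k) = dxs K ∨ (dxs J : PolyForm k) = -dxs K := by
  induction h with
  | nil => simp
  | cons i _ ih => rcases ih with h | h <;> simp [h]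
  | swap i j J =>
    right
    rw [dxs_cons, dxs_cons, dxs_cons, dxs_cons, ← mul_assoc, dx_mul_comm, neg_mul, mul_assoc]
  | trans _ _ h1 h2 => rcases h1 with h1 | h1 <;> rcases h2 with h2 | h2 <;> simp [h1, h2]

theorem grad_X (i : ℕ) : grad (X i : MvPolynomial ℕ k) = Finsupp.single i 1 :=
  mkDerivation_X _ _ _

theorem jet_X (i : ℕ) :
    jet (X i : MvPolynomial ℕ k) = algebraMap (MvPolynomial ℕ k) (PolyForm k) (X i) + dx i := by
  rw [jet_apply, grad_X, dx]

theorem jet_one : jet (1 : MvPolynomial ℕ k) = 1 := by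
  simp [jet_apply]

theorem jet_mul_dxs_monomial (a : ℕ →₀ ℕ) (J : List ℕ) :
    jet (monomial a (1 : k)) * dxs J = algebraMap _ (PolyForm k) (monomial a (1 : k)) * dxs J +
      a.sum fun l n => algebraMap _ (PolyForm k) (monomial (a - Finsupp.single l 1) (n : k)) *
        dxs (l :: J) := by
  rw [jet_apply, grad, mkDerivation_monomial, one_smul, add_mul, Finsupp.sum, map_sum,
    Finset.sum_mul, Finsupp.sum]
  congr 1
  refine Finset.sum_congr rfl fun l _ => ?_
  rw [map_smul, Algebra.smul_def, dxs_cons, dx, mul_assoc]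

variable (k) in
/-- The homomorphism `x_i ↦ x_i + dx_i` from the free algebra to polynomial differential forms. -/
def toForm : FreeAlgebra k ℕ →ₐ[k] PolyForm k := FreeAlgebra.lift k fun i => jet (X i)

theorem toForm_xx (i : ℕ) :
    toForm k (xx k i) = algebraMap (MvPolynomial ℕ k) (PolyForm k) (X i) + dx i := by
  rw [toForm, xx, FreeAlgebra.lift_ι_apply, jet_X]

theorem brk_jet (P Q : MvPolynomial ℕ k) :
    brk (jet P) (jet Q) = 2 * (oneForm (grad P) * oneForm (grad Q)) := by
  have h1 := commute_coeff P (algebraMap _ (PolyForm k) Q)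
  have h2 := commute_coeff P (oneForm (grad Q))
  have h3 := commute_coeff Q (oneForm (grad P))
  have h4 := oneForm_mul_comm (grad Q) (grad P)
  rw [brk, jet_apply, jet_apply]
  simp only [add_mul, mul_add, h1.eq, h2.eq, h3.eq, h4]
  noncomm_ring

theorem toForm_brk (i j : ℕ) : toForm k (brk (xx k i) (xx k j)) = 2 * dxs [i, j] := by
  have := brk_jet (X i : MvPolynomial ℕ k) (X j)
  rw [brk, jet_X, jet_X, grad_X, grad_X] at this
  rw [brk, map_sub, map_mul, map_mul, toForm_xx, toForm_xx, this]
  simp [dx]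

theorem exists_toForm_eq_jet (h2 : (2 : k) ≠ 0) (P : MvPolynomial ℕ k) :
    ∃ U, toForm k U = jet P := by
  induction P using MvPolynomial.induction_on with
  | C c =>
    refine ⟨algebraMap k _ c, ?_⟩
    rw [AlgHom.commutes, jet_apply, grad, derivation_C, map_zero, add_zero,
      ← MvPolynomial.algebraMap_eq, ← IsScalarTower.algebraMap_apply]
  | add P Q hP hQ =>
    obtain ⟨U, hU⟩ := hP
    obtain ⟨V, hV⟩ := hQ
    exact ⟨U + V, by rw [map_add, map_add, hU, hV]⟩
  | mul_X P i hP =>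
    obtain ⟨U, hU⟩ := hP
    refine ⟨(2 : k)⁻¹ • (U * xx k i + xx k i * U), ?_⟩
    rw [map_smul, inv_smul_eq_iff₀ h2, map_add, map_mul, map_mul, hU, toForm_xx, jet_apply,
      jet_apply, Derivation.leibniz, grad_X, map_add, map_smul, map_smul, ← dx]
    have h1 := commute_coeff P (dx i)
    have h3 := commute_coeff (X i : MvPolynomial ℕ k) (oneForm (grad P))
    have h4 : dx i * oneForm (grad P) = -(oneForm (grad P) * dx i) := oneForm_mul_comm _ _
    have h5 := commute_coeff P (algebraMap (MvPolynomial ℕ k) (PolyForm k) (X i))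
    rw [two_smul, Algebra.smul_def, Algebra.smul_def, map_mul]
    simp only [add_mul, mul_add, ← h1.eq, ← h3.eq, h4, h5.eq]
    abel

/-- The forms `(P + dP) dx_J`, with `J` of even length, are values of `toForm`. -/
theorem exists_toForm_eq_jet_mul_dxs (h2 : (2 : k) ≠ 0) (P : MvPolynomial ℕ k) :
    ∀ J : List ℕ, Even J.length → ∃ U, toForm k U = jet P * dxs J
  | [], _ => by simpa using exists_toForm_eq_jet h2 P
  | [i], h => by simp at h
  | i :: j :: J, h => by
    obtain ⟨U, hU⟩ := exists_toForm_eq_jet_mul_dxs h2 P J (by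
      simpa [Nat.even_add_one] using h)
    refine ⟨(2 : k)⁻¹ • (U * brk (xx k i) (xx k j)), ?_⟩
    rw [map_smul, inv_smul_eq_iff₀ h2, map_mul, hU, toForm_brk, two_smul]
    have h3 : Commute (dxs J) (dxs [i, j] : PolyForm k) := by
      have h3 (l : ℕ) : Commute (dxs J) (dx l : PolyForm k) :=
        (commute_oneForm_dxs _ (by simpa [Nat.even_add_one] using h)).symm
      simpa using (h3 i).mul_right (h3 j)
    rw [show i :: j :: J = [i, j] ++ J from rfl, dxs_append, ← h3.eq]
    noncomm_ring

/-- The linear map `∑ m_l dx_l ↦ ∑ dm_l dx_l`. -/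
def extD : (ℕ →₀ MvPolynomial ℕ k) →ₗ[k] PolyForm k :=
  Finsupp.lsum k fun l =>
    LinearMap.mulRight k (dx l) ∘ₗ (oneForm (k := k)).restrictScalars k ∘ₗ
      (grad (k := k) : _ →ₗ[k] _)

theorem extD_single (l : ℕ) (P : MvPolynomial ℕ k) :
    extD (Finsupp.single l P) = oneForm (grad P) * dx l := by
  simp [extD]

theorem extD_smul (P : MvPolynomial ℕ k) (m : ℕ →₀ MvPolynomial ℕ k) :
    extD (P • m) = P • extD m + oneForm (grad P) * oneForm m := by
  induction m using Finsupp.induction_linear with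
  | zero => simp
  | add m m' h h' => rw [smul_add, map_add, map_add, h, h', map_add, smul_add, mul_add]; abel
  | single l Q =>
    rw [Finsupp.smul_single, extD_single, extD_single, smul_eq_mul, Derivation.leibniz, map_add,
      map_smul, map_smul, add_mul, smul_mul_assoc, smul_mul_assoc, oneForm_single, mul_smul_comm]

theorem extD_grad (P : MvPolynomial ℕ k) : extD (grad P) = 0 := by
  induction P using MvPolynomial.induction_on with
  | C c => rw [grad, derivation_C, map_zero]
  | add P Q hP hQ => rw [map_add, map_add, hP, hQ, add_zero]
  | mul_X P i hP =>
    rw [Derivation.leibniz, map_add, extD_smul, extD_smul, hP, grad_X, extD_single, ← dx,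
      dx, oneForm_mul_comm (Finsupp.single i 1), Derivation.map_one_eq_zero]
    simp

/-- The `k`-span of the `(P + dP) dx_J` with `J` of even length. -/
def evenJets (k : Type*) [Field k] : Submodule k (PolyForm k) :=
  Submodule.span k {y | ∃ (P : MvPolynomial ℕ k) (J : List ℕ), Even J.length ∧ y = jet P * dxs J}

theorem oneForm_add_extD_mul_dxs (j : ℕ) (J : List ℕ) (m : ℕ →₀ MvPolynomial ℕ k) :
    (oneForm m + extD m) * dxs (j :: J) = m.sum fun l P => jet P * dxs (l :: j :: J) := by
  induction m using Finsupp.induction_linear with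
  | zero => simp
  | add m m' h h' =>
    rw [Finsupp.sum_add_index' (by simp) (by intros; rw [map_add, add_mul]), ← h, ← h', map_add,
      map_add]
    noncomm_ring
  | single l P =>
    have : oneForm (Finsupp.single l P) = algebraMap _ (PolyForm k) P * dx l := by
      rw [oneForm_single, Algebra.smul_def]
    rw [Finsupp.sum_single_index (by simp), extD_single, jet_apply, dxs_cons l, this]
    noncomm_ring

/-- `dP dx_J = ∑ (∂_l P + d ∂_l P) dx_l dx_J` for nonempty `J`. -/
theorem oneForm_grad_mul_dxs (j : ℕ) (J : List ℕ) (P : MvPolynomial ℕ k) :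
    oneForm (grad P) * dxs (j :: J) = (grad P).sum fun l Q => jet Q * dxs (l :: j :: J) := by
  rw [← oneForm_add_extD_mul_dxs, extD_grad, add_zero]

theorem mul_toForm_xx_mem {y : PolyForm k} (hy : y ∈ evenJets k) (i : ℕ) :
    y * toForm k (xx k i) ∈ evenJets k := by
  induction hy using Submodule.span_induction with
  | zero => simp
  | add a b _ _ ha hb => rw [add_mul]; exact add_mem ha hb
  | smul c a _ ha => rw [smul_mul_assoc]; exact Submodule.smul_mem _ _ ha
  | mem y hy =>
    obtain ⟨P, J, hJ, rfl⟩ := hy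
    have h1 : jet P * dxs J * toForm k (xx k i) =
        jet (P * X i) * dxs J + oneForm (grad P) * dxs (i :: J) := by
      have h1 : Commute (dx i) (dxs J : PolyForm k) := commute_oneForm_dxs _ hJ
      have h2 := commute_coeff (X i : MvPolynomial ℕ k) (dxs J : PolyForm k)
      have h3 := commute_coeff (X i : MvPolynomial ℕ k) (oneForm (grad P))
      rw [toForm_xx, mul_assoc, mul_add, ← h1.eq, ← h2.eq, dxs_cons, jet_apply, jet_apply,
        Derivation.leibniz, grad_X, map_add, map_smul, map_smul, Algebra.smul_def,
        Algebra.smul_def, h3.eq, map_mul, ← dx]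
      noncomm_ring
    rw [h1]
    refine add_mem (Submodule.subset_span ⟨_, _, hJ, rfl⟩) ?_
    rw [oneForm_grad_mul_dxs]
    exact Submodule.sum_mem _ fun l _ => Submodule.subset_span ⟨_, _, by
      simpa [Nat.even_add_one] using hJ, rfl⟩

theorem mul_toForm_mem (f : FreeAlgebra k ℕ) {y : PolyForm k} (hy : y ∈ evenJets k) :
    y * toForm k f ∈ evenJets k := by
  induction f using FreeAlgebra.induction generalizing y with
  | grade0 r => rw [AlgHom.commutes, ← Algebra.commutes, ← Algebra.smul_def]
                exact Submodule.smul_mem _ _ hy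
  | grade1 i => exact mul_toForm_xx_mem hy i
  | mul a b ha hb => rw [map_mul, ← mul_assoc]; exact hb (ha hy)
  | add a b ha hb => rw [map_add, mul_add]; exact add_mem (ha hy) (hb hy)

theorem toForm_mem_evenJets (f : FreeAlgebra k ℕ) : toForm k f ∈ evenJets k := by
  rw [← one_mul (toForm k f)]
  exact mul_toForm_mem f (Submodule.subset_span ⟨1, [], by simp, by simp [jet_one]⟩)

/-- The list `j 1, j 2, …, j (2 n)`. -/
def pairs (j : ℕ → ℕ) : ℕ → List ℕ
  | 0 => []
  | n + 1 => pairs j n ++ [j (2 * n + 1), j (2 * n + 2)]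

theorem length_pairs (j : ℕ → ℕ) (n : ℕ) : (pairs j n).length = 2 * n := by
  induction n with
  | zero => rfl
  | succ n ih => simp [pairs, ih, mul_add]

theorem exists_pairs_eq (J : List ℕ) (hJ : Even J.length) :
    ∃ j, pairs j (J.length / 2) = J := by
  refine ⟨fun i => J.getD (i - 1) 0, ?_⟩
  have key (n : ℕ) (hn : 2 * n ≤ J.length) :
      pairs (fun i => J.getD (i - 1) 0) n = J.take (2 * n) := by
    induction n with
    | zero => simp [pairs]
    | succ n ih =>
      have h1 : 2 * n < J.length := by omega
      have h2 : 2 * n + 1 < J.length := by omega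
      rw [pairs, ih (by omega), show 2 * (n + 1) = 2 * n + 1 + 1 by ring,
        List.take_succ_eq_append_getElem h2, List.take_succ_eq_append_getElem h1, List.append_assoc]
      congr 1
      simp [h1, h2]
  rw [key _ (Nat.mul_div_le _ _), Nat.mul_div_cancel' hJ.two_dvd, List.take_length]

theorem toForm_hh (ψ : FreeAlgebra k ℕ →ₐ[k] FreeAlgebra k ℕ) (j : ℕ → ℕ) (n : ℕ)
    (hψ : ∀ i, i ≤ 2 * n → ψ (xx k i) = xx k (j i)) :
    toForm k (ψ (hh k n)) = (2 : k) ^ n • dxs (pairs j n) := by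
  induction n with
  | zero => simp [hh, pairs]
  | succ n ih =>
    have ih := ih fun i hi => hψ i (by omega)
    rw [hh] at ih ⊢
    rw [List.range_succ, List.map_append, List.prod_append, map_mul, map_mul, ih]
    have h : ψ (brk (xx k (2 * n + 1)) (xx k (2 * n + 2))) =
        brk (xx k (j (2 * n + 1))) (xx k (j (2 * n + 2))) := by
      rw [brk, map_sub, map_mul, map_mul, hψ _ (by omega), hψ _ (by omega), brk]
    rw [List.map_singleton, List.prod_singleton, h, toForm_brk, pairs, dxs_append, pow_succ,
      mul_smul, smul_mul_assoc, two_mul, mul_add, two_smul]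

theorem dx_mul_toForm_pow (i r : ℕ) :
    dx i * toForm k (xx k i) ^ r =
      algebraMap _ (PolyForm k) ((X : ℕ → MvPolynomial ℕ k) i ^ r) * dx i := by
  induction r with
  | zero => simp
  | succ r ih =>
    have h := commute_coeff (X i : MvPolynomial ℕ k) (dx i)
    rw [pow_succ, ← mul_assoc, ih, toForm_xx, mul_assoc, mul_add, dx_mul_self, add_zero, ← h.eq,
      pow_succ, map_mul, mul_assoc]

theorem toForm_ww (p : ℕ) (ψ : FreeAlgebra k ℕ →ₐ[k] FreeAlgebra k ℕ) (j : ℕ → ℕ) (n : ℕ)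
    (hψ : ∀ i, i ≤ 2 * n → ψ (xx k i) = xx k (j i)) :
    toForm k (ψ (ww k p n)) = (2 : k) ^ n •
      (algebraMap _ (PolyForm k) ((pairs j n).map fun l => (X l : MvPolynomial ℕ k) ^ (p - 1)).prod
        * dxs (pairs j n)) := by
  induction n with
  | zero => simp [ww, pairs]
  | succ n ih =>
    have ih := ih fun i hi => hψ i (by omega)
    rw [ww] at ih ⊢
    rw [List.range_succ, List.map_append, List.prod_append, map_mul, map_mul, ih]
    have h : ψ (brk (xx k (2 * n + 1)) (xx k (2 * n + 2)) * xx k (2 * n + 1) ^ (p - 1) *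
        xx k (2 * n + 2) ^ (p - 1)) = brk (xx k (j (2 * n + 1))) (xx k (j (2 * n + 2))) *
        xx k (j (2 * n + 1)) ^ (p - 1) * xx k (j (2 * n + 2)) ^ (p - 1) := by
      rw [map_mul, map_mul, map_pow, map_pow, brk, map_sub, map_mul, map_mul,
        hψ _ (by omega), hψ _ (by omega), brk]
    have h' (a b : ℕ) : toForm k (brk (xx k a) (xx k b) * xx k a ^ (p - 1) * xx k b ^ (p - 1)) =
        (2 : k) • (algebraMap _ (PolyForm k)
          ((X : ℕ → MvPolynomial ℕ k) a ^ (p - 1) * X b ^ (p - 1)) * dxs [a, b]) := by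
      rw [map_mul, map_mul, toForm_brk, map_pow, map_pow, two_smul, two_mul, add_mul, add_mul]
      have h1 : (dxs [a, b] : PolyForm k) * toForm k (xx k a) ^ (p - 1) *
          toForm k (xx k b) ^ (p - 1) = algebraMap _ (PolyForm k)
            ((X : ℕ → MvPolynomial ℕ k) a ^ (p - 1) * X b ^ (p - 1)) * dxs [a, b] := by
        have h2 := commute_coeff (X a ^ (p - 1) : MvPolynomial ℕ k) (dx b)
        have h3 := commute_coeff (X b ^ (p - 1) : MvPolynomial ℕ k) (dx a)
        rw [dxs_cons, dxs_cons, dxs_nil, mul_one, dx_mul_comm, neg_mul, mul_assoc (dx b),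
          dx_mul_toForm_pow, ← mul_assoc (dx b), ← h2.eq, mul_assoc _ (dx b), ← mul_neg,
          ← dx_mul_comm, mul_assoc, mul_assoc, dx_mul_toForm_pow, ← mul_assoc (dx a), ← h3.eq,
          map_mul, mul_assoc, mul_assoc]
      rw [h1]
    rw [List.map_singleton, List.prod_singleton, h, h', pairs, dxs_append, pow_succ,
      mul_smul, smul_mul_assoc, mul_smul_comm, List.map_append, List.prod_append]
    have h3 := commute_coeff ((X (j (2 * n + 1)) : MvPolynomial ℕ k) ^ (p - 1) *
      X (j (2 * n + 2)) ^ (p - 1)) (dxs (pairs j n))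
    rw [List.map_cons, List.map_singleton, List.prod_pair, RingHom.map_mul _ (List.prod _),
      h3.symm.mul_mul_mul_comm]

/-- Evaluation of differential forms at central values of the variables and anticommuting
square-zero values of their differentials. -/
theorem exists_eval {A : Type*} [Ring A] [Algebra k A] (t : ℕ → Subalgebra.center k A) (o : ℕ → A)
    (ho : ∀ i j, o i * o j + o j * o i = 0) (ho' : ∀ i, o i * o i = 0) :
    ∃ ev : PolyForm k →ₐ[k] A,
      (∀ P, ev (algebraMap _ (PolyForm k) P) = (aeval (R := k) t P : Subalgebra.center k A)) ∧
      ∀ i, ev (dx i) = o i := by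
  let alg : Algebra (MvPolynomial ℕ k) A :=
    (((Subalgebra.center k A).val.comp (aeval t)) : MvPolynomial ℕ k →+* A).toAlgebra'
      fun P y => ((Subalgebra.mem_center_iff.1 (aeval t P).2) y).symm
  have alg_def (P : MvPolynomial ℕ k) :
      algebraMap (MvPolynomial ℕ k) A P = (aeval t P : Subalgebra.center k A) := rfl
  have : IsScalarTower k (MvPolynomial ℕ k) A := IsScalarTower.of_algebraMap_eq fun c => by
    rw [alg_def, MvPolynomial.algebraMap_eq, aeval_C]; rfl
  let f : (ℕ →₀ MvPolynomial ℕ k) →ₗ[MvPolynomial ℕ k] A := Finsupp.linearCombination _ o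
  have hf (i : ℕ) (P : MvPolynomial ℕ k) : f (Finsupp.single i P) = P • o i := by simp [f]
  have hanti (m m' : ℕ →₀ MvPolynomial ℕ k) : f m * f m' + f m' * f m = 0 := by
    induction m using Finsupp.induction_linear with
    | zero => simp
    | add a b ha hb =>
      rw [map_add, add_mul, mul_add, add_add_add_comm, ha, hb, add_zero]
    | single i P =>
      induction m' using Finsupp.induction_linear with
      | zero => simp
      | add a b ha hb =>
        rw [map_add, add_mul, mul_add, add_add_add_comm, ha, hb, add_zero]
      | single j Q =>
        rw [hf, hf, smul_mul_smul_comm, smul_mul_smul_comm, mul_comm Q P, ← smul_add, ho, smul_zero]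
  have hsq (m : ℕ →₀ MvPolynomial ℕ k) : f m * f m = 0 := by
    induction m using Finsupp.induction_linear with
    | zero => simp
    | add a b ha hb =>
      have := hanti a b
      rw [map_add, add_mul, mul_add, mul_add, ha, hb, zero_add, add_zero, this]
    | single i P => rw [hf, smul_mul_smul_comm, ho', smul_zero]
  let ev : PolyForm k →ₐ[MvPolynomial ℕ k] A := ExteriorAlgebra.lift _ ⟨f, hsq⟩
  refine ⟨ev.restrictScalars k, fun P => ev.commutes P, fun i => ?_⟩
  have : ev (ExteriorAlgebra.ι _ (Finsupp.single i 1)) = f (Finsupp.single i 1) :=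
    ExteriorAlgebra.lift_ι_apply _ _ _ _
  exact this.trans (by rw [hf, one_smul])

end PolyForm

namespace ExteriorAlgebra

variable (k : Type*) [Field k] (V : Type*) [AddCommGroup V] [Module k V]

/-- The multiples of vectors by central elements. -/
def centralMulVec : Submodule k (ExteriorAlgebra k V) :=
  Subalgebra.toSubmodule (Subalgebra.center k (ExteriorAlgebra k V)) * LinearMap.range (ι k)

variable {k V}

theorem mem_center_of_commute_ι {z : ExteriorAlgebra k V} (h : ∀ v, ι k v * z = z * ι k v) :
    z ∈ Subalgebra.center k (ExteriorAlgebra k V) := by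
  refine Subalgebra.mem_center_iff.2 fun b => ?_
  induction b using ExteriorAlgebra.induction with
  | algebraMap r => exact Algebra.commutes r z
  | ι v => exact h v
  | mul a b ha hb => rw [mul_assoc, hb, ← mul_assoc, ha, mul_assoc]
  | add a b ha hb => rw [add_mul, mul_add, ha, hb]

theorem ι_mul_ι_comm (v w : V) : ι k v * ι k w = -(ι k w * ι k v) :=
  eq_neg_of_add_eq_zero_left (ι_add_mul_swap v w)

theorem ι_mul_ι_mem_center (v w : V) :
    ι k v * ι k w ∈ Subalgebra.center k (ExteriorAlgebra k V) := by
  refine mem_center_of_commute_ι fun u => ?_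
  rw [← mul_assoc, ι_mul_ι_comm u v, neg_mul, mul_assoc, ι_mul_ι_comm u w, mul_neg, neg_neg,
    mul_assoc]

theorem center_mul_center : Subalgebra.toSubmodule (Subalgebra.center k (ExteriorAlgebra k V)) *
    Subalgebra.toSubmodule (Subalgebra.center k (ExteriorAlgebra k V)) ≤
    Subalgebra.toSubmodule (Subalgebra.center k (ExteriorAlgebra k V)) :=
  Submodule.mul_le.2 fun _ ha _ hb => (Subalgebra.center k _).mul_mem ha hb

theorem mul_center_comm (S : Submodule k (ExteriorAlgebra k V)) :
    S * Subalgebra.toSubmodule (Subalgebra.center k (ExteriorAlgebra k V)) =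
      Subalgebra.toSubmodule (Subalgebra.center k (ExteriorAlgebra k V)) * S :=
  Submodule.mul_comm_of_commute fun a _ _ hb => (Subalgebra.mem_center_iff (R := k)).1 hb a

theorem centralMulVec_mul_le :
    centralMulVec k V * centralMulVec k V ≤
      Subalgebra.toSubmodule (Subalgebra.center k (ExteriorAlgebra k V)) := by
  rw [centralMulVec, mul_assoc, ← mul_assoc (LinearMap.range _), mul_center_comm, mul_assoc,
    ← mul_assoc]
  refine (mul_le_mul' center_mul_center (Submodule.mul_le.2 ?_)).trans center_mul_center
  rintro _ ⟨v, rfl⟩ _ ⟨w, rfl⟩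
  exact ι_mul_ι_mem_center v w

theorem center_mul_centralMulVec :
    Subalgebra.toSubmodule (Subalgebra.center k (ExteriorAlgebra k V)) * centralMulVec k V ≤
      centralMulVec k V := by
  rw [centralMulVec, ← mul_assoc]
  exact mul_le_mul' center_mul_center le_rfl

theorem center_sup_centralMulVec :
    Subalgebra.toSubmodule (Subalgebra.center k (ExteriorAlgebra k V)) ⊔ centralMulVec k V = ⊤ := by
  refine top_unique fun y _ => ?_
  induction y using ExteriorAlgebra.induction with
  | algebraMap r =>
    exact Submodule.mem_sup_left (Subalgebra.algebraMap_mem _ r)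
  | ι v =>
    refine Submodule.mem_sup_right ?_
    rw [← one_mul (ι k v)]
    exact Submodule.mul_mem_mul (one_mem (Subalgebra.center k _)) ⟨v, rfl⟩
  | add a b ha hb => exact add_mem (ha trivial) (hb trivial)
  | mul a b ha hb =>
    have h := Submodule.mul_mem_mul (ha trivial) (hb trivial)
    rw [Submodule.mul_sup, Submodule.sup_mul, Submodule.sup_mul,
      mul_center_comm (centralMulVec k V)] at h
    refine SetLike.le_def.1 (sup_le (sup_le ?_ ?_) (sup_le ?_ ?_)) h
    · exact center_mul_center.trans le_sup_left
    · exact center_mul_centralMulVec.trans le_sup_right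
    · exact center_mul_centralMulVec.trans le_sup_right
    · exact centralMulVec_mul_le.trans le_sup_left

theorem exists_center_add (y : ExteriorAlgebra k V) :
    ∃ t : Subalgebra.center k (ExteriorAlgebra k V), ∃ o ∈ centralMulVec k V, (t : _) + o = y := by
  obtain ⟨t, ht, o, ho, h⟩ := Submodule.mem_sup.1
    (center_sup_centralMulVec (k := k) (V := V) ▸ Submodule.mem_top (x := y))
  exact ⟨⟨t, ht⟩, o, ho, h⟩

theorem centralMulVec_anticomm {a b : ExteriorAlgebra k V} (ha : a ∈ centralMulVec k V)
    (hb : b ∈ centralMulVec k V) : a * b + b * a = 0 := by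
  rw [centralMulVec] at ha hb
  induction ha using Submodule.mul_induction_on' with
  | add a _ a' _ h h' => rw [add_mul, mul_add, add_add_add_comm, h, h', add_zero]
  | mem_mul_mem z hz e he =>
    induction hb using Submodule.mul_induction_on' with
    | add b _ b' _ h h' => rw [add_mul, mul_add, add_add_add_comm, h, h', add_zero]
    | mem_mul_mem w hw f hf =>
      obtain ⟨v, rfl⟩ := he
      obtain ⟨u, rfl⟩ := hf
      have hz := (Subalgebra.mem_center_iff (R := k)).1 hz
      have hw := (Subalgebra.mem_center_iff (R := k)).1 hw
      rw [mul_assoc, ← mul_assoc _ w, hw, mul_assoc w (ι k u), ← mul_assoc (ι k u) z, hz,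
        mul_assoc w (ι k v), mul_assoc z (ι k u), ι_mul_ι_comm v u, ← mul_assoc z w,
        ← mul_assoc w z, hw z, mul_neg, neg_add_cancel]

theorem centralMulVec_mul_self (h2 : (2 : k) ≠ 0) {a : ExteriorAlgebra k V}
    (ha : a ∈ centralMulVec k V) : a * a = 0 := by
  have h := centralMulVec_anticomm ha ha
  rw [← two_smul k] at h
  exact (smul_eq_zero.1 h).resolve_left h2

theorem prod_mem_center_mul_pow (l : List (ExteriorAlgebra k V))
    (hl : ∀ a ∈ l, a ∈ centralMulVec k V) :
    l.prod ∈ Subalgebra.toSubmodule (Subalgebra.center k (ExteriorAlgebra k V)) *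
      LinearMap.range (ι k (M := V)) ^ l.length := by
  induction l with
  | nil => simp
  | cons a l ih =>
    have h := Submodule.mul_mem_mul (hl a (by simp)) (ih fun b hb => hl b (by simp [hb]))
    rw [centralMulVec, mul_assoc, ← mul_assoc (LinearMap.range _), mul_center_comm, mul_assoc,
      ← mul_assoc, ← pow_succ'] at h
    exact mul_le_mul' center_mul_center le_rfl h

theorem pow_range_ι_eq_bot [FiniteDimensional k V] {n : ℕ} (hn : Module.finrank k V < n) :
    LinearMap.range (ι k (M := V)) ^ n = ⊥ := by
  have : LinearMap.range (ι k (M := V)) ^ n = ⋀[k]^n V := rfl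
  rw [this, ← ιMulti_span_fixedDegree, Submodule.span_eq_bot]
  rintro _ ⟨v, rfl⟩
  refine AlternatingMap.map_linearDependent _ _ fun h => ?_
  have := h.fintype_card_le_finrank
  rw [Fintype.card_fin] at this
  omega

theorem prod_eq_zero_of_finrank_lt [FiniteDimensional k V] (l : List (ExteriorAlgebra k V))
    (hl : ∀ a ∈ l, a ∈ centralMulVec k V) (h : Module.finrank k V < l.length) : l.prod = 0 := by
  have := prod_mem_center_mul_pow l hl
  rwa [pow_range_ι_eq_bot h, Submodule.mul_bot, Submodule.mem_bot] at this

theorem prod_mem_center_of_even : ∀ (l : List (ExteriorAlgebra k V)),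
    (∀ a ∈ l, a ∈ centralMulVec k V) → Even l.length →
    l.prod ∈ Subalgebra.center k (ExteriorAlgebra k V)
  | [], _, _ => one_mem _
  | [a], _, h => by simp at h
  | a :: b :: l, hl, h => by
    rw [List.prod_cons, List.prod_cons, ← mul_assoc]
    exact mul_mem (centralMulVec_mul_le (Submodule.mul_mem_mul (hl _ (by simp)) (hl _ (by simp))))
      (prod_mem_center_of_even l (fun c hc => hl c (by simp [hc]))
        (by simpa [Nat.even_add_one] using h))

theorem ι_mem_centralMulVec (v : V) : ι k v ∈ centralMulVec k V := by
  rw [← one_mul (ι k v)]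
  exact Submodule.mul_mem_mul (one_mem (Subalgebra.center k _)) ⟨v, rfl⟩

theorem prod_mem_center_of_finrank_le [FiniteDimensional k V] (l : List (ExteriorAlgebra k V))
    (hl : ∀ a ∈ l, a ∈ centralMulVec k V) (h : Module.finrank k V ≤ l.length) :
    l.prod ∈ Subalgebra.center k (ExteriorAlgebra k V) := by
  refine mem_center_of_commute_ι fun v => ?_
  have h1 := prod_eq_zero_of_finrank_lt (ι k v :: l)
    (by simpa using ⟨ι_mem_centralMulVec v, hl⟩) (by simpa using h.trans_lt (Nat.lt_succ_self _))
  have h2 := prod_eq_zero_of_finrank_lt (l ++ [ι k v])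
    (by
      intro a ha
      rcases List.mem_append.1 ha with ha | ha
      · exact hl a ha
      · rw [List.mem_singleton.1 ha]; exact ι_mem_centralMulVec v)
    (by simpa using h.trans_lt (Nat.lt_succ_self _))
  rw [List.prod_cons] at h1
  rw [List.prod_append, List.prod_singleton] at h2
  rw [h1, h2]

end ExteriorAlgebra

namespace PolyForm

open MvPolynomial

variable {k : Type*} [Field k]

open ExteriorAlgebra in
/-- Every homomorphism from the free algebra to an exterior algebra factors through `toForm`. -/
theorem exists_eval_toForm {V : Type*} [AddCommGroup V] [Module k V] (h2 : (2 : k) ≠ 0)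
    (φ : FreeAlgebra k ℕ →ₐ[k] ExteriorAlgebra k V) :
    ∃ ev : PolyForm k →ₐ[k] ExteriorAlgebra k V, (∀ f, φ f = ev (toForm k f)) ∧
      (∀ P : MvPolynomial ℕ k, ev (algebraMap (MvPolynomial ℕ k) (PolyForm k) P) ∈
        Subalgebra.center k (ExteriorAlgebra k V)) ∧
      ∀ i, ev (dx i) ∈ centralMulVec k V := by
  choose t o ho hto using fun i => exists_center_add (φ (xx k i))
  obtain ⟨ev, h1, h3⟩ := exists_eval t o (fun i j => centralMulVec_anticomm (ho i) (ho j))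
    fun i => centralMulVec_mul_self h2 (ho i)
  refine ⟨ev, fun f => ?_, fun P => ?_, fun i => ?_⟩
  · have : φ = ev.comp (toForm k) := by
      refine FreeAlgebra.hom_ext (funext fun i => ?_)
      have h4 : ev (toForm k (xx k i)) = φ (xx k i) := by
        rw [toForm_xx, map_add, h1, h3, aeval_X, hto]
      exact h4.symm
    rw [this, AlgHom.comp_apply]
  · rw [h1]; exact Subtype.property _
  · rw [h3]; exact ho i

variable (k) in
/-- The T-space generated by the central polynomials of the theorem. -/
def centralTSpace (p m : ℕ) : Submodule k (FreeAlgebra k ℕ) :=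
  Submodule.span k {y : FreeAlgebra k ℕ |
    ∃ ψ : FreeAlgebra k ℕ →ₐ[k] FreeAlgebra k ℕ,
      y = ψ (brk (xx k 1) (xx k 2)) ∨
      y = ψ ((xx k 1) ^ p) ∨
      y = ψ (xx k (2 * (m / 2 + 1) - 1) * hh k (m / 2 + 1 - 1)) ∨
      ∃ n, 1 ≤ n ∧ y = ψ ((xx k (2 * n + 1)) ^ p * ww k p n)}

variable (k) in
/-- The polynomial identities of the exterior algebra of `k ^ m`. -/
def identities (m : ℕ) : Submodule k (FreeAlgebra k ℕ) :=
  ⨅ φ : FreeAlgebra k ℕ →ₐ[k] ExteriorAlgebra k (Fin m → k), LinearMap.ker φ.toLinearMap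

theorem mem_identities {m : ℕ} {f : FreeAlgebra k ℕ} : f ∈ identities k m ↔
    ∀ φ : FreeAlgebra k ℕ →ₐ[k] ExteriorAlgebra k (Fin m → k), φ f = 0 := by
  simp [identities, Submodule.mem_iInf]

/-- The central polynomials of the exterior algebra of `k ^ m`. -/
def IsCentralPoly (m : ℕ) (f : FreeAlgebra k ℕ) : Prop :=
  ∀ φ : FreeAlgebra k ℕ →ₐ[k] ExteriorAlgebra k (Fin m → k), ∀ a, φ f * a = a * φ f

theorem isCentralPoly_iff {m : ℕ} {f : FreeAlgebra k ℕ} : IsCentralPoly m f ↔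
    ∀ φ : FreeAlgebra k ℕ →ₐ[k] ExteriorAlgebra k (Fin m → k), φ f ∈ Subalgebra.center k _ := by
  refine forall_congr' fun φ => ?_
  rw [Subalgebra.mem_center_iff]
  exact forall_congr' fun a => eq_comm

variable (k) in
/-- The image of `centralTSpace k p m + identities k m` in the differential forms. -/
def centralForms (p m : ℕ) : Submodule k (PolyForm k) :=
  (centralTSpace k p m ⊔ identities k m).map (toForm k).toLinearMap

theorem toForm_mem_centralForms {p m : ℕ} {f : FreeAlgebra k ℕ} (hf : f ∈ centralTSpace k p m) :
    toForm k f ∈ centralForms k p m :=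
  ⟨f, Submodule.mem_sup_left hf, rfl⟩

theorem eval_dxs {A : Type*} [Ring A] [Algebra k A] (ev : PolyForm k →ₐ[k] A) (J : List ℕ) :
    ev (dxs J) = (J.map fun i => ev (dx i)).prod := by
  rw [dxs, map_list_prod, List.map_map]; rfl

theorem jet_mul_dxs_mem_of_lt_length (h2 : (2 : k) ≠ 0) (p : ℕ) {m : ℕ} (P : MvPolynomial ℕ k)
    {J : List ℕ} (hJ : Even J.length) (hm : m < J.length) :
    jet P * dxs J ∈ centralForms k p m := by
  obtain ⟨U, hU⟩ := exists_toForm_eq_jet_mul_dxs h2 P J hJ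
  rw [← hU]
  refine ⟨U, Submodule.mem_sup_right (mem_identities.2 fun φ => ?_), rfl⟩
  obtain ⟨ev, h1, -, h3⟩ := exists_eval_toForm h2 φ
  rw [h1, hU, map_mul, eval_dxs, ExteriorAlgebra.prod_eq_zero_of_finrank_lt, mul_zero]
  · simpa using fun i _ => h3 i
  · simpa using hm

theorem jet_mul_dxs_mem_of_length_eq (h2 : (2 : k) ≠ 0) (p : ℕ) {m : ℕ} (P : MvPolynomial ℕ k)
    {J : List ℕ} (hJ : J.length = 2 * (m / 2)) :
    jet P * dxs J ∈ centralForms k p m := by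
  obtain ⟨U, hU⟩ := exists_toForm_eq_jet h2 P
  obtain ⟨j, hj⟩ := exists_pairs_eq J (by rw [hJ]; exact even_two_mul _)
  rw [hJ, Nat.mul_div_cancel_left _ two_pos] at hj
  let ψ : FreeAlgebra k ℕ →ₐ[k] FreeAlgebra k ℕ :=
    FreeAlgebra.lift k fun i => if i ≤ 2 * (m / 2) then xx k (j i) else U
  have hψ (i : ℕ) : ψ (xx k i) = if i ≤ 2 * (m / 2) then xx k (j i) else U :=
    FreeAlgebra.lift_ι_apply _ _
  have h : toForm k (ψ (xx k (2 * (m / 2 + 1) - 1) * hh k (m / 2 + 1 - 1))) =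
      (2 : k) ^ (m / 2) • (jet P * dxs J) := by
    rw [Nat.add_sub_cancel, map_mul, map_mul, hψ, if_neg (by omega), hU,
      toForm_hh ψ j _ (fun i hi => by rw [hψ, if_pos hi]), hj, mul_smul_comm]
  have h' : (2 : k) ^ (m / 2) • (jet P * dxs J) ∈ centralForms k p m := by
    rw [← h]
    exact toForm_mem_centralForms (Submodule.subset_span ⟨ψ, Or.inr (Or.inr (Or.inl rfl))⟩)
  exact (Submodule.smul_mem_iff _ (pow_ne_zero _ h2)).1 h'

theorem toForm_brk_mem (p m : ℕ) (U V : FreeAlgebra k ℕ) :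
    toForm k (brk U V) ∈ centralForms k p m := by
  refine toForm_mem_centralForms (Submodule.subset_span
    ⟨FreeAlgebra.lift k fun i => if i = 1 then U else V, Or.inl ?_⟩)
  simp [brk, xx]

theorem jet_pow_char (p : ℕ) [CharP k p] [Fact p.Prime] (P : MvPolynomial ℕ k) :
    jet P ^ p = algebraMap _ (PolyForm k) (P ^ p) := by
  have : CharP (PolyForm k) p :=
    charP_of_injective_algebraMap (FaithfulSMul.algebraMap_injective k (PolyForm k)) p
  have hp := (Fact.out : p.Prime).two_le
  have h0 : oneForm (grad P) ^ p = 0 := by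
    rw [← Nat.sub_add_cancel hp, pow_add, pow_two, oneForm_mul_self, mul_zero]
  rw [jet_apply, add_pow_char_of_commute p (commute_coeff _ _), h0, add_zero, map_pow]

theorem pow_char_mul_mem (h2 : (2 : k) ≠ 0) (p m : ℕ) [CharP k p] [Fact p.Prime]
    (P : MvPolynomial ℕ k) {J : List ℕ} (hJ : Even J.length) :
    algebraMap _ (PolyForm k) (P ^ p * (J.map fun l => (X l : MvPolynomial ℕ k) ^ (p - 1)).prod) *
      dxs J ∈ centralForms k p m := by
  obtain ⟨U, hU⟩ := exists_toForm_eq_jet h2 P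
  rcases Nat.eq_zero_or_pos (J.length / 2) with h0 | hpos
  · obtain rfl : J = [] := by
      have := hJ.two_dvd
      exact List.length_eq_zero_iff.1 (by omega)
    have h : toForm k (U ^ p) ∈ centralForms k p m := toForm_mem_centralForms <|
      Submodule.subset_span ⟨FreeAlgebra.lift k fun _ => U, Or.inr (Or.inl (by simp [xx]))⟩
    rw [map_pow, hU, jet_pow_char p] at h
    simpa using h
  obtain ⟨j, hj⟩ := exists_pairs_eq J hJ
  set n := J.length / 2
  let ψ : FreeAlgebra k ℕ →ₐ[k] FreeAlgebra k ℕ :=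
    FreeAlgebra.lift k fun i => if i ≤ 2 * n then xx k (j i) else U
  have hψ (i : ℕ) : ψ (xx k i) = if i ≤ 2 * n then xx k (j i) else U :=
    FreeAlgebra.lift_ι_apply _ _
  have h : toForm k (ψ ((xx k (2 * n + 1)) ^ p * ww k p n)) = (2 : k) ^ n •
      (algebraMap _ (PolyForm k)
        (P ^ p * (J.map fun l => (X l : MvPolynomial ℕ k) ^ (p - 1)).prod) * dxs J) := by
    rw [map_mul, map_mul, map_pow, map_pow, hψ, if_neg (by omega), hU, jet_pow_char p,
      toForm_ww p ψ j _ (fun i hi => by rw [hψ, if_pos hi]), hj, mul_smul_comm,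
      RingHom.map_mul _ (P ^ p), mul_assoc]
  refine (Submodule.smul_mem_iff _ (pow_ne_zero n h2)).1 ?_
  rw [← h]
  exact toForm_mem_centralForms (Submodule.subset_span
    ⟨ψ, Or.inr (Or.inr (Or.inr ⟨n, hpos, rfl⟩))⟩)

theorem isCentralPoly_of_mem (h2 : (2 : k) ≠ 0) {p m : ℕ} [CharP k p] [Fact p.Prime]
    {f : FreeAlgebra k ℕ} (hf : f ∈ centralTSpace k p m) : IsCentralPoly m f := by
  refine isCentralPoly_iff.2 fun φ => ?_
  induction hf using Submodule.span_induction with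
  | zero => rw [map_zero]; exact zero_mem _
  | add a b _ _ ha hb => rw [map_add]; exact add_mem ha hb
  | smul c a _ ha => rw [map_smul]; exact Subalgebra.smul_mem _ ha c
  | mem y hy =>
    obtain ⟨ψ, hy⟩ := hy
    obtain ⟨ev, h1, hc, ho⟩ := exists_eval_toForm h2 (φ.comp ψ)
    simp only [AlgHom.comp_apply] at h1
    have hev (J : List ℕ) (hJ : Even J.length) : ev (dxs J) ∈ Subalgebra.center k _ := by
      rw [eval_dxs]
      exact ExteriorAlgebra.prod_mem_center_of_even _ (by simpa using fun i _ => ho i) (by simpa)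
    have hp (i : ℕ) : ev (toForm k (xx k i ^ p)) ∈ Subalgebra.center k _ := by
      rw [map_pow, toForm_xx, ← jet_X, jet_pow_char p]; exact hc _
    rcases hy with rfl | rfl | rfl | ⟨n, -, rfl⟩
    · rw [h1, toForm_brk, two_mul, map_add]
      exact add_mem (hev _ (by simp)) (hev _ (by simp))
    · rw [h1]; exact hp 1
    · have h := toForm_hh (AlgHom.id k _) id (m / 2) fun _ _ => rfl
      rw [AlgHom.id_apply] at h
      have hl := length_pairs id (m / 2)
      rw [h1, Nat.add_sub_cancel, map_mul, h, mul_smul_comm, map_smul]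
      refine Subalgebra.smul_mem _ ?_ _
      rw [toForm_xx, add_mul, ← dxs_cons, map_add, map_mul]
      refine add_mem (mul_mem (hc _) (hev _ (by rw [hl]; exact even_two_mul _))) ?_
      rw [eval_dxs]
      refine ExteriorAlgebra.prod_mem_center_of_finrank_le _ (by
        intro a ha
        obtain ⟨i, -, rfl⟩ := List.mem_map.1 ha
        exact ho i) ?_
      rw [List.length_map, List.length_cons, hl, Module.finrank_fin_fun]
      omega
    · have h := toForm_ww p (AlgHom.id k _) id n fun _ _ => rfl
      rw [AlgHom.id_apply] at h
      rw [h1, map_mul, h, map_mul, map_smul, map_mul]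
      exact mul_mem (hp _) (Subalgebra.smul_mem _
        (mul_mem (hc _) (hev _ (by rw [length_pairs]; exact even_two_mul _))) _)

theorem prod_map_X_pow (r : ℕ) (J : List ℕ) :
    (J.map fun l => (X l : MvPolynomial ℕ k) ^ r).prod =
      monomial (r • Multiset.toFinsupp (J : Multiset ℕ)) 1 := by
  induction J with
  | nil => simp
  | cons l J ih =>
    rw [List.map_cons, List.prod_cons, ih, X_pow_eq_monomial, monomial_mul, mul_one,
      ← Multiset.cons_coe, ← Multiset.singleton_add, map_add, Multiset.toFinsupp_singleton,
      smul_add, Finsupp.smul_single, smul_eq_mul, mul_one]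

theorem jet_mul_dxs_mem_of_forall_cast_eq_zero (h2 : (2 : k) ≠ 0) (p m : ℕ) [CharP k p]
    [hp : Fact p.Prime] (a : ℕ →₀ ℕ) {J : List ℕ} (hJ : Even J.length) (hn : J.Nodup)
    (ha : ∀ i, ((a i + J.count i : ℕ) : k) = 0) :
    jet (monomial a (1 : k)) * dxs J ∈ centralForms k p m := by
  have h0 : (a.sum fun l n => algebraMap _ (PolyForm k)
      (monomial (a - Finsupp.single l 1) (n : k)) * dxs (l :: J)) = 0 := by
    refine Finset.sum_eq_zero fun l _ => ?_
    dsimp only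
    by_cases hl : l ∈ J
    · rw [dxs_cons, dx_mul_dxs_of_mem hl, mul_zero]
    · have := ha l
      rw [List.count_eq_zero_of_not_mem hl, add_zero] at this
      rw [this, monomial_zero, map_zero, zero_mul]
  rw [jet_mul_dxs_monomial, h0, add_zero]
  have h := pow_char_mul_mem h2 p m
    (monomial (a.mapRange (· / p) (Nat.zero_div p)) (1 : k)) hJ
  rw [prod_map_X_pow, monomial_pow, one_pow, monomial_mul, one_mul] at h
  convert h using 5
  ext i
  have hp1 := hp.out.two_le
  obtain ⟨c, hc⟩ := (CharP.cast_eq_zero_iff k p _).1 (ha i)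
  simp only [Finsupp.add_apply, Finsupp.smul_apply, Finsupp.mapRange_apply,
    Multiset.toFinsupp_apply, Multiset.coe_count, smul_eq_mul]
  by_cases hl : i ∈ J
  · rw [List.count_eq_one_of_mem hn hl] at hc ⊢
    obtain ⟨c, rfl⟩ : ∃ d, c = d + 1 := Nat.exists_eq_succ_of_ne_zero (by rintro rfl; omega)
    have h1 : a i = p * c + (p - 1) := by rw [mul_add] at hc; omega
    rw [h1, Nat.mul_add_div hp.out.pos, Nat.div_eq_of_lt (Nat.sub_lt hp.out.pos one_pos)]
    simp
  · rw [List.count_eq_zero_of_not_mem hl] at hc ⊢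
    rw [show a i = p * c from hc, Nat.mul_div_cancel_left _ hp.out.pos]
    simp

theorem commute_jet_dxs (P : MvPolynomial ℕ k) {J : List ℕ} (hJ : Even J.length) :
    Commute (jet P) (dxs J) :=
  (commute_coeff _ _).add_left (commute_oneForm_dxs _ hJ)

theorem grad_mul_dxs_mem (h2 : (2 : k) ≠ 0) (p m : ℕ) (P : MvPolynomial ℕ k) (j : ℕ) {J : List ℕ}
    (hJ : Even J.length) : oneForm (grad P) * dxs (j :: J) ∈ centralForms k p m := by
  obtain ⟨U, hU⟩ := exists_toForm_eq_jet_mul_dxs h2 P J hJ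
  have h := toForm_brk_mem p m U (xx k j)
  have h1 : toForm k (brk U (xx k j)) = (2 : k) • (oneForm (grad P) * dxs (j :: J)) := by
    have h3 : toForm k (brk U (xx k j)) = brk (jet P) (jet (X j : MvPolynomial ℕ k)) * dxs J := by
      rw [brk, brk, map_sub, map_mul, map_mul, hU, toForm_xx, ← jet_X, sub_mul, mul_assoc,
        ← (commute_jet_dxs (X j) hJ).eq, mul_assoc, mul_assoc]
    rw [h3, brk_jet, grad_X, dxs_cons, mul_assoc, mul_assoc, two_smul, two_mul]
    rfl
  rw [h1] at h
  exact (Submodule.smul_mem_iff _ h2).1 h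

theorem grad_monomial_apply (a : ℕ →₀ ℕ) (l : ℕ) :
    grad (monomial a (1 : k)) l = monomial (a - Finsupp.single l 1) (a l : k) := by
  rw [grad, mkDerivation_monomial, one_smul, Finsupp.sum, Finsupp.finsetSum_apply]
  simp only [Finsupp.smul_single, smul_eq_mul, mul_one, Finsupp.single_apply]
  rw [Finset.sum_ite_eq' ]
  split_ifs with h
  · rfl
  · rw [Finsupp.notMem_support_iff.1 h, Nat.cast_zero, monomial_zero]

theorem jet_mul_dxs_cons_cons_mem (h2 : (2 : k) ≠ 0) (p m : ℕ) (a : ℕ →₀ ℕ) (i j : ℕ) {J : List ℕ}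
    (hJ : Even J.length) (hi : ((a i + 1 : ℕ) : k) ≠ 0) {W : Submodule k (PolyForm k)}
    (hW : centralForms k p m ≤ W)
    (H : ∀ l, l ∉ i :: j :: J → a l ≠ 0 →
      jet (monomial (a + Finsupp.single i 1 - Finsupp.single l 1) (1 : k)) *
        dxs (l :: j :: J) ∈ W) :
    jet (monomial a (1 : k)) * dxs (i :: j :: J) ∈ W := by
  classical
  set b := a + Finsupp.single i 1 with hb
  have h := hW (grad_mul_dxs_mem h2 p m (monomial b (1 : k)) j hJ)
  have hs : (grad (monomial b (1 : k))).support ⊆ b.support := fun l hl => by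
    rw [Finsupp.mem_support_iff, grad_monomial_apply] at hl
    rw [Finsupp.mem_support_iff]
    rintro h0
    exact hl (by rw [h0, Nat.cast_zero, monomial_zero])
  have hbi : b i = a i + 1 := by simp [hb]
  have hib : i ∈ b.support := by
    rw [Finsupp.mem_support_iff, hbi]; omega
  rw [oneForm_grad_mul_dxs, Finsupp.sum_of_support_subset _ hs _ (by simp),
    ← Finset.add_sum_erase _ _ hib] at h
  have hterm (l : ℕ) : jet (grad (monomial b (1 : k)) l) * dxs (l :: j :: J) =
      (b l : k) • (jet (monomial (b - Finsupp.single l 1) (1 : k)) * dxs (l :: j :: J)) := by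
    rw [grad_monomial_apply, ← smul_mul_assoc, ← map_smul, smul_monomial, smul_eq_mul, mul_one]
  have hrest : ∑ l ∈ b.support.erase i,
      jet (grad (monomial b (1 : k)) l) * dxs (l :: j :: J) ∈ W := by
    refine sum_mem fun l hl => ?_
    obtain ⟨hli, hl⟩ := Finset.mem_erase.1 hl
    by_cases hlJ : l ∈ j :: J
    · rw [dxs_cons, dx_mul_dxs_of_mem hlJ, mul_zero]; exact zero_mem _
    · rw [hterm]
      refine W.smul_mem _ (H l (by simp_all) ?_)
      simpa [hb, Finsupp.single_apply, Ne.symm hli] using hl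
  have h1 := (Submodule.add_mem_iff_left _ hrest).1 h
  rw [hterm, hbi, show b - Finsupp.single i 1 = a by rw [hb, add_tsub_cancel_right]] at h1
  exact (Submodule.smul_mem_iff _ hi).1 h1

variable (k) in
/-- An index at which the multidegree `D` is nonzero in `k`, if there is one. -/
def pivot (D : ℕ →₀ ℕ) : ℕ := Classical.epsilon fun i => (D i : k) ≠ 0

/-- The multidegree of the form `x ^ a dx_J`. -/
def multidegree (a : ℕ →₀ ℕ) (J : Multiset ℕ) : ℕ →₀ ℕ := a + Multiset.toFinsupp J

theorem multidegree_apply (a : ℕ →₀ ℕ) (J : Multiset ℕ) (i : ℕ) :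
    multidegree a J i = a i + J.count i := by simp [multidegree]

variable (k) in
/-- The indices of the forms which span the even forms modulo `centralForms`. -/
def reducedIndices (m : ℕ) : Set ((ℕ →₀ ℕ) × Finset ℕ) :=
  {x | Even x.2.card ∧ x.2.card + 1 < m ∧
    (multidegree x.1 x.2.1 (pivot k (multidegree x.1 x.2.1)) : k) ≠ 0 ∧
    pivot k (multidegree x.1 x.2.1) ∉ x.2}

variable (k) in
/-- The jet of the monomial `x ^ a` times `dx_J`. -/
def monomialForm (x : (ℕ →₀ ℕ) × Finset ℕ) : PolyForm k :=
  jet (monomial x.1 (1 : k)) * dxs x.2.toList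

variable (k) in
/-- The span of `centralForms` and of the reduced forms. -/
def reducedSpan (p m : ℕ) : Submodule k (PolyForm k) :=
  centralForms k p m ⊔ Submodule.span k (monomialForm k '' reducedIndices k m)

theorem jet_mul_dxs_mem_of_perm {P : MvPolynomial ℕ k} {J K : List ℕ} (h : J.Perm K)
    {W : Submodule k (PolyForm k)} (hW : jet P * dxs K ∈ W) : jet P * dxs J ∈ W := by
  rcases dxs_perm (k := k) h with h | h
  · rwa [h]
  · rw [h, mul_neg]; exact neg_mem hW

theorem jet_mul_dxs_mem_of_pivot_notMem (h2 : (2 : k) ≠ 0) (p m : ℕ) (a : ℕ →₀ ℕ) {J : List ℕ}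
    (hJ : Even J.length) (hn : J.Nodup)
    (h0 : (multidegree a J (pivot k (multidegree a J)) : k) ≠ 0)
    (hJ' : pivot k (multidegree a J) ∉ J) :
    jet (monomial a (1 : k)) * dxs J ∈ reducedSpan k p m := by
  classical
  rcases lt_or_ge (J.length + 1) m with h | h
  · have hval : J.toFinset.1 = (J : Multiset ℕ) := by
      rw [List.toFinset_val, hn.dedup]
    have hcard : J.toFinset.card = J.length := List.toFinset_card_of_nodup hn
    refine Submodule.mem_sup_right (jet_mul_dxs_mem_of_perm (List.toFinset_toList hn).symm
      (Submodule.subset_span ⟨(a, J.toFinset), ⟨?_, ?_, ?_, ?_⟩, rfl⟩))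
    · rwa [hcard]
    · rwa [hcard]
    · dsimp only; rwa [hval]
    · dsimp only; rwa [hval, List.mem_toFinset]
  · refine Submodule.mem_sup_left ?_
    rcases lt_or_ge m J.length with h' | h'
    · exact jet_mul_dxs_mem_of_lt_length h2 p _ hJ h'
    · obtain ⟨r, hr⟩ := hJ
      exact jet_mul_dxs_mem_of_length_eq h2 p _ (by omega)

theorem jet_mul_dxs_mem_reducedSpan (h2 : (2 : k) ≠ 0) (p m : ℕ) [CharP k p] [Fact p.Prime]
    (P : MvPolynomial ℕ k) {J : List ℕ} (hJ : Even J.length) :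
    jet P * dxs J ∈ reducedSpan k p m := by
  classical
  by_cases hn : J.Nodup
  swap
  · rw [dxs_eq_zero_of_not_nodup hn, mul_zero]; exact zero_mem _
  induction P using MvPolynomial.induction_on' with
  | add P Q hP hQ => rw [map_add, add_mul]; exact add_mem hP hQ
  | monomial a c =>
    rw [← mul_one c, ← smul_eq_mul c 1, ← smul_monomial, map_smul, smul_mul_assoc]
    refine Submodule.smul_mem _ _ ?_
    by_cases h0 : (multidegree a J (pivot k (multidegree a J)) : k) = 0
    · refine Submodule.mem_sup_left
        (jet_mul_dxs_mem_of_forall_cast_eq_zero h2 p m a hJ hn fun i => ?_)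
      by_contra hi
      refine Classical.epsilon_spec (p := fun i => (multidegree a J i : k) ≠ 0) ⟨i, ?_⟩ h0
      rwa [multidegree_apply, Multiset.coe_count]
    by_cases hJ' : pivot k (multidegree a J) ∈ J
    · obtain ⟨i, hi⟩ : ∃ i, i = pivot k (multidegree a J) := ⟨_, rfl⟩
      rw [← hi] at h0 hJ'
      have hperm := List.perm_cons_erase hJ'
      rcases hK : J.erase i with - | ⟨j, K⟩
      · rw [hK] at hperm
        rw [hperm.length_eq] at hJ
        simp at hJ
      rw [hK] at hperm
      have hlen := hperm.length_eq
      have hn' := hperm.nodup_iff.1 hn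
      refine jet_mul_dxs_mem_of_perm hperm
        (jet_mul_dxs_cons_cons_mem h2 p m a i j ?_ ?_ le_sup_left fun l hl hal => ?_)
      · rw [hlen] at hJ
        simpa [Nat.even_add_one] using hJ
      · rwa [multidegree_apply, Multiset.coe_count, List.count_eq_one_of_mem hn hJ'] at h0
      · have hD : multidegree (a + Finsupp.single i 1 - Finsupp.single l 1)
            (l :: j :: K : List ℕ) = multidegree a J := by
          have hsub : Finsupp.single l 1 ≤ a + Finsupp.single i 1 :=
            Finsupp.single_le_iff.2 (by rw [Finsupp.add_apply]; omega)
          rw [multidegree, multidegree, Multiset.coe_eq_coe.2 hperm, ← Multiset.cons_coe l,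
            ← Multiset.cons_coe i, ← Multiset.singleton_add l, ← Multiset.singleton_add i, map_add,
            map_add, Multiset.toFinsupp_singleton, Multiset.toFinsupp_singleton, ← add_assoc,
            ← add_assoc, tsub_add_cancel_of_le hsub]
        have hli : i ≠ l := fun h => hl (by simp [h])
        refine jet_mul_dxs_mem_of_pivot_notMem h2 p m _ ?_ ?_ ?_ ?_
        · rw [hlen] at hJ
          simpa using hJ
        · rw [List.nodup_cons] at hn' ⊢
          exact ⟨fun h => hl (List.mem_cons_of_mem _ h), hn'.2⟩
        · rw [hD, ← hi]; exact h0
        · rw [hD, ← hi, List.mem_cons, not_or]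
          exact ⟨hli, (List.nodup_cons.1 hn').1⟩
    · exact jet_mul_dxs_mem_of_pivot_notMem h2 p m a hJ hn h0 hJ'

/-- Every value of `toForm` is a central form up to a combination of reduced forms. -/
theorem toForm_mem_reducedSpan (h2 : (2 : k) ≠ 0) (p m : ℕ) [CharP k p] [Fact p.Prime]
    (f : FreeAlgebra k ℕ) : toForm k f ∈ reducedSpan k p m := by
  refine (Submodule.span_le.2 ?_ : evenJets k ≤ reducedSpan k p m) (toForm_mem_evenJets f)
  rintro _ ⟨P, J, hJ, rfl⟩
  exact jet_mul_dxs_mem_reducedSpan h2 p m P hJ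

theorem prod_map_ι_single {m : ℕ} (r : List (Fin m)) :
    (r.map fun i => ExteriorAlgebra.ι k (Pi.single i 1 : Fin m → k)).prod =
      ExteriorAlgebra.ιMulti k r.length (fun i => (Pi.single (r.get i) 1 : Fin m → k)) := by
  rw [ExteriorAlgebra.ιMulti_apply]
  congr 1
  refine List.ext_getElem (by simp) fun i _ _ => by simp

theorem prod_map_ι_single_eq_zero {m : ℕ} {r : List (Fin m)} (hr : ¬ r.Nodup) :
    (r.map fun i => ExteriorAlgebra.ι k (Pi.single i 1 : Fin m → k)).prod = 0 := by
  rw [prod_map_ι_single]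
  refine ExteriorAlgebra.ιMulti_eq_zero_of_not_inj fun h => hr (List.nodup_iff_injective_get.2 ?_)
  exact Function.Injective.of_comp (f := fun i => (Pi.single i 1 : Fin m → k)) h

theorem prod_map_ι_single_ne_zero {m : ℕ} {r : List (Fin m)} (hr : r.Nodup) :
    (r.map fun i => ExteriorAlgebra.ι k (Pi.single i 1 : Fin m → k)).prod ≠ 0 := by
  intro h
  rw [prod_map_ι_single] at h
  have h2 := ExteriorAlgebra.liftAlternating_apply_ιMulti (R := k)
    (Pi.single r.length ((Matrix.detRowAlternating (R := k) (n := Fin r.length)).compLinearMap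
      (LinearMap.funLeft k k r.get))) (fun i => (Pi.single (r.get i) 1 : Fin m → k))
  rw [h, map_zero, Pi.single_eq_same, AlternatingMap.compLinearMap_apply] at h2
  have h3 : (fun i => LinearMap.funLeft k k r.get (Pi.single (r.get i) 1 : Fin m → k)) =
      (1 : Matrix (Fin r.length) (Fin r.length) k) := by
    ext i j
    rw [LinearMap.funLeft_apply, Matrix.one_apply, Pi.single_apply]
    simp only [(List.nodup_iff_injective_get.1 hr).eq_iff, eq_comm]
  rw [h3] at h2
  exact zero_ne_one (h2.trans Matrix.det_one)

theorem exists_eval_commutator {V : Type*} [AddCommGroup V] [Module k V] (s : ℕ → k) (v : ℕ → V) :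
    ∃ ev : PolyForm k →ₐ[k] ExteriorAlgebra k V, ∀ w (a : ℕ →₀ ℕ) (J : List ℕ), Even J.length →
      ev (jet (monomial a (1 : k)) * dxs J) * ExteriorAlgebra.ι k w -
        ExteriorAlgebra.ι k w * ev (jet (monomial a (1 : k)) * dxs J) =
      (2 : k) • ∑ l ∈ a.support, eval s (monomial (a - Finsupp.single l 1) (a l : k)) •
        (((l :: J).map fun i => ExteriorAlgebra.ι k (v i)).prod * ExteriorAlgebra.ι k w) := by
  obtain ⟨ev, h1, h3⟩ := exists_eval (A := ExteriorAlgebra k V)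
    (fun i => algebraMap k (Subalgebra.center k (ExteriorAlgebra k V)) (s i))
    (fun i => ExteriorAlgebra.ι k (v i)) (fun i j => ExteriorAlgebra.ι_add_mul_swap _ _)
    fun i => ExteriorAlgebra.ι_sq_zero _
  have hP (P : MvPolynomial ℕ k) :
      ev (algebraMap _ (PolyForm k) P) = algebraMap k _ (eval s P) := by
    rw [h1]
    have : aeval (fun i => algebraMap k (Subalgebra.center k (ExteriorAlgebra k V)) (s i)) P =
        algebraMap k _ (eval s P) := by
      exact (aeval_algebraMap_apply (Subalgebra.center k (ExteriorAlgebra k V)) s P).trans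
        (by rw [aeval_eq_eval])
    rw [this]; rfl
  refine ⟨ev, fun w a J hJ => ?_⟩
  have hev (K : List ℕ) : ev (dxs K) = (K.map fun i => ExteriorAlgebra.ι k (v i)).prod := by
    rw [eval_dxs]; simp only [h3]
  have hcen : (J.map fun i => ExteriorAlgebra.ι k (v i)).prod ∈
      Subalgebra.center k (ExteriorAlgebra k V) :=
    ExteriorAlgebra.prod_mem_center_of_even _
      (by simpa using fun i _ => ExteriorAlgebra.ι_mem_centralMulVec (v i)) (by simpa)
  have hcen := Subalgebra.mem_center_iff.1 hcen
  have hodd (l : ℕ) : ExteriorAlgebra.ι k w *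
      ((l :: J).map fun i => ExteriorAlgebra.ι k (v i)).prod =
      -(((l :: J).map fun i => ExteriorAlgebra.ι k (v i)).prod * ExteriorAlgebra.ι k w) := by
    rw [List.map_cons, List.prod_cons, ← mul_assoc, ExteriorAlgebra.ι_mul_ι_comm, neg_mul,
      mul_assoc, hcen, mul_assoc]
  rw [jet_mul_dxs_monomial, map_add, map_mul, hP, hev, ← Algebra.smul_def, Finsupp.sum, map_sum,
    add_mul, mul_add, smul_mul_assoc, mul_smul_comm, hcen, add_sub_add_left_eq_sub, Finset.sum_mul,
    Finset.mul_sum, ← Finset.sum_sub_distrib, Finset.smul_sum]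
  refine Finset.sum_congr rfl fun l _ => ?_
  rw [map_mul, hP, hev, ← Algebra.smul_def, smul_mul_assoc, mul_smul_comm, hodd, smul_neg,
    sub_neg_eq_add, two_smul]

/-- The reduced forms are linearly independent modulo the forms of central polynomials. -/
theorem eq_zero_of_isCentralPoly [Infinite k] (h2 : (2 : k) ≠ 0) {m : ℕ}
    {c : ((ℕ →₀ ℕ) × Finset ℕ) →₀ k} (hc : ↑c.support ⊆ reducedIndices k m)
    {g : FreeAlgebra k ℕ} (hg : IsCentralPoly m g)
    (h : toForm k g = Finsupp.linearCombination k (monomialForm k) c) : c = 0 := by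
  classical
  by_contra hne
  obtain ⟨⟨a₀, J₀⟩, hx₀, hmin⟩ := Finset.exists_min_image c.support (fun x => x.2.card)
    (Finsupp.support_nonempty_iff.2 hne)
  obtain ⟨-, hcard, hD, hpiv⟩ := hc hx₀
  obtain ⟨i₀, hi₀⟩ : ∃ i, i = pivot k (multidegree a₀ J₀.1) := ⟨_, rfl⟩
  dsimp only at hD hpiv hcard hmin
  rw [← hi₀] at hD hpiv
  rw [multidegree_apply, Multiset.count_eq_zero_of_notMem hpiv, add_zero] at hD
  set L := i₀ :: J₀.toList with hL
  have hLn : L.Nodup := List.nodup_cons.2 ⟨by simpa using hpiv, J₀.nodup_toList⟩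
  have hLm : L.length < m := by simpa [hL] using hcard
  let f (l : ℕ) : Fin m := ⟨L.idxOf l, List.idxOf_le_length.trans_lt hLm⟩
  let q : Fin m := ⟨L.length, hLm⟩
  let F (K : List ℕ) : ExteriorAlgebra k (Fin m → k) :=
    (K.map fun i => ExteriorAlgebra.ι k (Pi.single (f i) 1 : Fin m → k)).prod *
      ExteriorAlgebra.ι k (Pi.single q 1 : Fin m → k)
  have hF (K : List ℕ) : F K =
      ((K.map f ++ [q]).map fun i => ExteriorAlgebra.ι k (Pi.single i 1 : Fin m → k)).prod := by
    rw [List.map_append, List.map_map, List.prod_append, List.map_singleton, List.prod_singleton]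
    rfl
  have hF0 {K : List ℕ} (hK : F K ≠ 0) : K.Nodup ∧ K ⊆ L := by
    have h1 : (K.map f ++ [q]).Nodup := by
      by_contra h1
      exact hK (by rw [hF, prod_map_ι_single_eq_zero h1])
    rw [List.nodup_append] at h1
    refine ⟨h1.1.of_map, fun l hl => ?_⟩
    by_contra hlL
    exact h1.2.2 (f l) (List.mem_map_of_mem hl) q (by simp)
      (Fin.ext (List.idxOf_eq_length_iff.2 hlL))
  have hFL : F L ≠ 0 := by
    rw [hF]
    refine prod_map_ι_single_ne_zero (List.nodup_append.2 ⟨?_, by simp, ?_⟩)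
    · refine hLn.map_on fun x hx y _ hxy => ?_
      exact (List.idxOf_inj hx).1 (Fin.ext_iff.1 hxy)
    · intro _ hx _ hy
      obtain ⟨l, hl, rfl⟩ := List.mem_map.1 hx
      rw [List.mem_singleton.1 hy]
      exact fun hlq => (List.idxOf_lt_length_of_mem hl).ne (Fin.ext_iff.1 hlq)
  have hsum (s : ℕ → k) : ∑ x ∈ c.support, c x • ∑ l ∈ x.1.support,
      eval s (monomial (x.1 - Finsupp.single l 1) (x.1 l : k)) • F (l :: x.2.toList) = 0 := by
    obtain ⟨ev, hev⟩ := exists_eval_commutator s fun i => (Pi.single (f i) 1 : Fin m → k)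
    have h3 := sub_eq_zero.2 (hg (ev.comp (toForm k)) (ExteriorAlgebra.ι k (Pi.single q 1)))
    rw [AlgHom.comp_apply, h, Finsupp.linearCombination_apply, Finsupp.sum, map_sum,
      Finset.sum_mul, Finset.mul_sum, ← Finset.sum_sub_distrib] at h3
    refine (smul_eq_zero_iff_right h2).1 ?_
    rw [← h3, Finset.smul_sum]
    refine Finset.sum_congr rfl fun x hx => ?_
    rw [map_smul, smul_mul_assoc, mul_smul_comm, ← smul_sub, monomialForm, hev, smul_comm]
    simpa using (hc hx).1
  obtain ⟨Λ, hΛ⟩ := Module.Projective.exists_dual_ne_zero k hFL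
  have hpoly : ∑ x ∈ c.support, ∑ l ∈ x.1.support,
      monomial (x.1 - Finsupp.single l 1) (c x * x.1 l * Λ (F (l :: x.2.toList))) = 0 := by
    refine MvPolynomial.funext fun s => ?_
    have h4 := congrArg Λ (hsum s)
    rw [map_zero] at h4 ⊢
    rw [← h4, map_sum, map_sum]
    refine Finset.sum_congr rfl fun x _ => ?_
    rw [map_smul, map_sum, map_sum, Finset.smul_sum]
    refine Finset.sum_congr rfl fun l _ => ?_
    rw [map_smul, smul_eq_mul, smul_eq_mul, eval_monomial, eval_monomial]
    ring
  have hcoef := congrArg (coeff (a₀ - Finsupp.single i₀ 1)) hpoly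
  have ha₀ : a₀ i₀ ≠ 0 := by
    intro h0
    rw [h0, Nat.cast_zero] at hD
    exact hD rfl
  have key (x : (ℕ →₀ ℕ) × Finset ℕ) (hx : x ∈ c.support) (l : ℕ) (hl : l ∈ x.1.support)
      (heq : x.1 - Finsupp.single l 1 = a₀ - Finsupp.single i₀ 1) (hFl : F (l :: x.2.toList) ≠ 0) :
      x = (a₀, J₀) ∧ l = i₀ := by
    obtain ⟨hn, hsub⟩ := hF0 hFl
    have hperm : (l :: x.2.toList).Perm L :=
      (List.subperm_of_subset hn hsub).perm_of_length_le (by simpa [hL] using hmin x hx)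
    have hx1 : x.1 = a₀ - Finsupp.single i₀ 1 + Finsupp.single l 1 := by
      rw [← heq, tsub_add_cancel_of_le]
      exact Finsupp.single_le_iff.2 (Nat.one_le_iff_ne_zero.2 (Finsupp.mem_support_iff.1 hl))
    have ha1 : a₀ = a₀ - Finsupp.single i₀ 1 + Finsupp.single i₀ 1 := by
      rw [tsub_add_cancel_of_le]
      exact Finsupp.single_le_iff.2 (Nat.one_le_iff_ne_zero.2 ha₀)
    have hms : ({l} : Multiset ℕ) + x.2.1 = {i₀} + J₀.1 := by
      have := Multiset.coe_eq_coe.2 hperm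
      rwa [hL, ← Multiset.cons_coe, ← Multiset.cons_coe, Finset.coe_toList,
        Finset.coe_toList] at this
    have hdeg : multidegree x.1 x.2.1 = multidegree a₀ J₀.1 := by
      rw [multidegree, multidegree, hx1]
      conv_rhs => rw [ha1]
      rw [add_assoc, add_assoc, ← Multiset.toFinsupp_singleton, ← Multiset.toFinsupp_singleton,
        ← map_add, ← map_add, hms]
    have hpx := (hc hx).2.2.2
    rw [hdeg, ← hi₀] at hpx
    have hli : i₀ = l := by
      have : i₀ ∈ l :: x.2.toList := hperm.mem_iff.2 (by simp [hL])
      simpa [hpx] using this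
    subst hli
    exact ⟨Prod.ext (hx1.trans ha1.symm) (Finset.val_injective (add_left_cancel hms)), rfl⟩
  rw [coeff_zero, coeff_sum, Finset.sum_eq_single_of_mem _ hx₀, coeff_sum,
    Finset.sum_eq_single_of_mem i₀ (Finsupp.mem_support_iff.2 ha₀), coeff_monomial, if_pos rfl]
    at hcoef
  · exact mul_ne_zero (mul_ne_zero (Finsupp.mem_support_iff.1 hx₀) hD) hΛ hcoef
  · intro l hl hli
    rw [coeff_monomial]
    split_ifs with heq
    · by_contra hne0
      exact hli (key _ hx₀ l hl heq fun h0 => hne0 (by simp only [h0, map_zero, mul_zero])).2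
    · rfl
  · intro x hx hxx
    rw [coeff_sum]
    refine Finset.sum_eq_zero fun l hl => ?_
    rw [coeff_monomial]
    split_ifs with heq
    · by_contra hne0
      exact hxx (key x hx l hl heq fun h0 => hne0 (by rw [h0, map_zero, mul_zero])).1
    · rfl

/-- The central polynomials are the sum of the T-space and of the identities. -/
theorem isCentralPoly_iff_mem_sup [Infinite k] (h2 : (2 : k) ≠ 0) {p m : ℕ} [CharP k p]
    [Fact p.Prime] {f : FreeAlgebra k ℕ} :
    IsCentralPoly m f ↔ f ∈ centralTSpace k p m ⊔ identities k m := by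
  have hmem {f : FreeAlgebra k ℕ} (hf : f ∈ centralTSpace k p m ⊔ identities k m) :
      IsCentralPoly m f := by
    obtain ⟨u, hu, v, hv, rfl⟩ := Submodule.mem_sup.1 hf
    intro φ a
    rw [map_add, mem_identities.1 hv, add_zero, isCentralPoly_of_mem h2 hu]
  refine ⟨fun hf => ?_, hmem⟩
  obtain ⟨y, ⟨s, hs, hsy⟩, z, hz, hyz⟩ := Submodule.mem_sup.1 (toForm_mem_reducedSpan h2 p m f)
  obtain ⟨c, hc, hcz⟩ := (Finsupp.mem_span_image_iff_linearCombination k).1 hz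
  have hform : toForm k (f - s) = Finsupp.linearCombination k (monomialForm k) c := by
    rw [hcz, map_sub, ← hyz, ← hsy]
    exact add_sub_cancel_left _ _
  have hcentral : IsCentralPoly m (f - s) := fun φ a => by
    rw [map_sub, sub_mul, mul_sub, hf, hmem hs]
  rw [eq_zero_of_isCentralPoly h2 hc hcentral hform, map_zero] at hform
  rw [← add_sub_cancel s f]
  refine add_mem hs (Submodule.mem_sup_right (mem_identities.2 fun φ => ?_))
  obtain ⟨ev, hev, -⟩ := exists_eval_toForm h2 φ
  rw [hev, hform, map_zero]

end PolyForm

/-- Let `k` be an infinite field of characteristic `p > 2`, `m ≥ 2`,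
`b_m = ⌊m/2⌋ + 1`.  Then `CP(G(m)) = S_1(m) + T(G(m))`, where `S_1(m)` is the T-space
generated by `{[x_1,x_2], x_1^p, x_{2b_m-1} h_{b_m-1}} ∪ {x_{2k+1}^p w_k : k ≥ 1}`. -/
theorem stmt7 (k : Type*) [Field k] [Infinite k] (p : ℕ) [CharP k p] (hp : 2 < p)
    (m : ℕ) (hm : 2 ≤ m) :
    {f : FreeAlgebra k ℕ |
        ∀ φ : FreeAlgebra k ℕ →ₐ[k] ExteriorAlgebra k (Fin m → k),
          ∀ a, φ f * a = a * φ f} =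
    (↑(Submodule.span k {y : FreeAlgebra k ℕ |
          ∃ ψ : FreeAlgebra k ℕ →ₐ[k] FreeAlgebra k ℕ,
            y = ψ (brk (xx k 1) (xx k 2)) ∨
            y = ψ ((xx k 1) ^ p) ∨
            y = ψ (xx k (2 * (m / 2 + 1) - 1) * hh k (m / 2 + 1 - 1)) ∨
            ∃ n, 1 ≤ n ∧ y = ψ ((xx k (2 * n + 1)) ^ p * ww k p n)}) : Set (FreeAlgebra k ℕ))
      + {f : FreeAlgebra k ℕ |
          ∀ φ : FreeAlgebra k ℕ →ₐ[k] ExteriorAlgebra k (Fin m → k), φ f = 0} := by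
  have hprime : Fact p.Prime := ⟨(CharP.char_is_prime_or_zero k p).resolve_right (by omega)⟩
  have h2 : (2 : k) ≠ 0 := by
    intro h
    have h' : ((2 : ℕ) : k) = 0 := h
    exact absurd (Nat.le_of_dvd two_pos ((CharP.cast_eq_zero_iff k p 2).1 h')) (by omega)
  ext f
  refine (PolyForm.isCentralPoly_iff_mem_sup h2 (p := p)).trans ?_
  rw [Submodule.mem_sup, Set.mem_add]
  simp only [PolyForm.mem_identities]
  rfl

end
end
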